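/- Let E be an elementary path in Δ̄^(3) with vertices A, A*, B*, C*, C, B, let V = {A, B, C, A*, B*, C*}, and let K be the convex hull of E. Then there exists a proper 3-system P such that V ⊆ F(P) ⊆ K, and consequently K(P) = K. Moreover, if E is a strict elementary path, then P may be chosen to be self-similar and non-degenerate. -/

import Mathlib

open Filter Set Pointwise Topology

noncomputable section

/-- Points of `ℝ^n`. -/
abbrev RVec (n : ℕ) := Fin n → ℝ

/-- The vector of `ℝ^n` with a `1` in position `j` (0-based) and `0` elsewhere;
`eVec n 0` is the first canonical basis vector `e_1`. -/
def eVec (n : ℕ) (j : ℕ) : RVec n := fun i => if (i : ℕ) = j then 1 else 0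

/-- `P` is an `n`-system on the subinterval `I` of `[0,∞)`:
`I` is an order-connected subset of `[0,∞)` with nonempty interior, and conditions
(S1), (S2), (S3) hold at every `q ∈ I`. -/
def IsNSystem (n : ℕ) (I : Set ℝ) (P : ℝ → RVec n) : Prop :=
  I ⊆ Set.Ici (0 : ℝ) ∧ I.OrdConnected ∧ (interior I).Nonempty ∧
  ∀ q ∈ I,
    ((∀ i, 0 ≤ P q i) ∧ Monotone (P q) ∧ (∑ i, P q i) = q) ∧
    ∃ ε > (0 : ℝ), ∃ k ℓ : Fin n,
      (∀ t ∈ I ∩ Set.Icc (q - ε) q, P t = P q + (t - q) • eVec n ℓ) ∧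
      (∀ t ∈ I ∩ Set.Icc q (q + ε), P t = P q + (t - q) • eVec n k) ∧
      (q ∈ interior I → ℓ < k → ∀ i : Fin n, ℓ ≤ i → i ≤ k → P q i = P q ℓ)

/-- `P` is a proper `n`-system on `I`: it is an `n`-system whose first component is
unbounded (by the monotonicity (S1) of the components, this is equivalent to all
components simultaneously exceeding any given bound). -/
def IsProperSys (n : ℕ) (I : Set ℝ) (P : ℝ → RVec n) : Prop :=
  IsNSystem n I P ∧ ∀ M : ℝ, ∃ q ∈ I, ∀ i, M < P q i

/-- The set `F(P)` of limits of `q_i⁻¹ • P(q_i)` along strictly increasing unbounded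
sequences `(q_i)` in `I`. -/
def FSet (n : ℕ) (I : Set ℝ) (P : ℝ → RVec n) : Set (RVec n) :=
  {x | ∃ q : ℕ → ℝ, (∀ i, q i ∈ I) ∧ StrictMono q ∧
    Tendsto q atTop atTop ∧ Tendsto (fun i => (q i)⁻¹ • P (q i)) atTop (𝓝 x)}

/-- The set `F(P, e₁)`: as `F(P)`, but with the extra requirement that the right
derivative of `P` at each `q_i` is the first basis vector `e_1`. -/
def FSetE1 (n : ℕ) (I : Set ℝ) (P : ℝ → RVec n) : Set (RVec n) :=
  {x | ∃ q : ℕ → ℝ, (∀ i, q i ∈ I) ∧ StrictMono q ∧ Tendsto q atTop atTop ∧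
    (∀ i, ∃ ε > (0 : ℝ), ∀ t ∈ I ∩ Set.Icc (q i) (q i + ε),
      P t = P (q i) + (t - q i) • eVec n 0) ∧
    Tendsto (fun i => (q i)⁻¹ • P (q i)) atTop (𝓝 x)}

/-- `q` is a switch number of the `n`-system `P` on `I`: a point of `I` on the boundary
of `I`, or an interior point where the local slopes `e_k` (right) and `e_ℓ` (left)
from (S2) satisfy `k < ℓ`. -/
def IsSwitchNumber (n : ℕ) (I : Set ℝ) (P : ℝ → RVec n) (q : ℝ) : Prop :=
  q ∈ I ∧ (q ∈ frontier I ∨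
    (q ∈ interior I ∧ ∃ ε > (0 : ℝ), ∃ k ℓ : Fin n, k < ℓ ∧
      (∀ t ∈ I ∩ Set.Icc (q - ε) q, P t = P q + (t - q) • eVec n ℓ) ∧
      (∀ t ∈ I ∩ Set.Icc q (q + ε), P t = P q + (t - q) • eVec n k)))

/-- `q` is a division number of the `n`-system `P` on `I`: a point of `I` on the boundary
of `I`, or an interior point where `P` is not differentiable, i.e. where the left and
right slopes from (S2) differ. -/
def IsDivisionNumber (n : ℕ) (I : Set ℝ) (P : ℝ → RVec n) (q : ℝ) : Prop :=
  q ∈ I ∧ (q ∈ frontier I ∨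
    (q ∈ interior I ∧ ∃ ε > (0 : ℝ), ∃ k ℓ : Fin n, k ≠ ℓ ∧
      (∀ t ∈ I ∩ Set.Icc (q - ε) q, P t = P q + (t - q) • eVec n ℓ) ∧
      (∀ t ∈ I ∩ Set.Icc q (q + ε), P t = P q + (t - q) • eVec n k)))

/-- A non-degenerate `n`-system: an `n`-system whose domain is a closed subinterval
of `(0,∞)` and whose switch points all have `n` distinct positive coordinates. -/
def IsNonDegenerate (n : ℕ) (I : Set ℝ) (P : ℝ → RVec n) : Prop :=
  IsNSystem n I P ∧ IsClosed I ∧ I ⊆ Set.Ioi (0 : ℝ) ∧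
  ∀ q, IsSwitchNumber n I P q → (∀ i, 0 < P q i) ∧ StrictMono (P q)

/-- A rigid `n`-system of mesh `δ`: a non-degenerate `n`-system whose switch points
belong to `δℤ^n`. -/
def IsRigid (n : ℕ) (δ : ℝ) (I : Set ℝ) (P : ℝ → RVec n) : Prop :=
  IsNonDegenerate n I P ∧
  ∀ q, IsSwitchNumber n I P q → ∀ i, ∃ m : ℤ, P q i = δ * m

/-- A self-similar system: the domain is unbounded and there is `ρ > 1` with
`P(ρq) = ρ • P(q)` for all `q` in the domain. -/
def IsSelfSimilar (n : ℕ) (I : Set ℝ) (P : ℝ → RVec n) : Prop :=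
  ¬ BddAbove I ∧ ∃ ρ : ℝ, 1 < ρ ∧ ∀ q ∈ I, ρ * q ∈ I ∧ P (ρ * q) = ρ • P q

/-- The cube `[-ε, ε]^n`. -/
def cubeNbhd (n : ℕ) (ε : ℝ) : Set (RVec n) := {y | ∀ i, |y i| ≤ ε}

/-- The distance `dist(E, F)`: the infimum of all `ε > 0` such that
`E ⊆ F + [-ε,ε]^n` and `F ⊆ E + [-ε,ε]^n`. -/
def cubeDist (n : ℕ) (E F : Set (RVec n)) : ℝ :=
  sInf {ε : ℝ | 0 < ε ∧ E ⊆ F + cubeNbhd n ε ∧ F ⊆ E + cubeNbhd n ε}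

/-- `μ_T(P)`: the point of `ℝ^m` whose `j`-th coordinate is
`liminf_{q → ∞, q ∈ I} T_j(P(q))/q`. -/
def muT (n m : ℕ) (T : RVec n → RVec m) (I : Set ℝ) (P : ℝ → RVec n) : RVec m :=
  fun j => Filter.liminf (fun q => T (P q) j / q) (atTop ⊓ 𝓟 I)

/-- `liminf` of a sequence of subsets of `ℝ^n`: the set of limits of convergent
sequences `(x_i)` with `x_i ∈ F i` for every `i`. -/
def setLiminf (n : ℕ) (F : ℕ → Set (RVec n)) : Set (RVec n) :=
  {x | ∃ y : ℕ → RVec n, (∀ i, y i ∈ F i) ∧ Tendsto y atTop (𝓝 x)}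

/-- `limsup` of a sequence of subsets of `ℝ^n`: the set of accumulation points of
sequences `(x_i)` with `x_i ∈ F i` for every `i`, i.e. limits of convergent
subsequences. -/
def setLimsup (n : ℕ) (F : ℕ → Set (RVec n)) : Set (RVec n) :=
  {x | ∃ (y : ℕ → RVec n) (φ : ℕ → ℕ), (∀ i, y i ∈ F i) ∧ StrictMono φ ∧
    Tendsto (y ∘ φ) atTop (𝓝 x)}
/-- The closed triangle `Δ̄⁽³⁾ = {0 ≤ x₁ ≤ x₂ ≤ x₃, x₁ + x₂ + x₃ = 1}`. -/
def DeltaBar3 : Set (RVec 3) :=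
  {x | 0 ≤ x 0 ∧ x 0 ≤ x 1 ∧ x 1 ≤ x 2 ∧ x 0 + x 1 + x 2 = 1}

/-- The open triangle `Δ⁽³⁾ = {0 < x₁ < x₂ < x₃, x₁ + x₂ + x₃ = 1}`. -/
def DeltaOpen3 : Set (RVec 3) :=
  {x | 0 < x 0 ∧ x 0 < x 1 ∧ x 1 < x 2 ∧ x 0 + x 1 + x 2 = 1}

def e1v : RVec 3 := ![1, 0, 0]
def e2v : RVec 3 := ![0, 1, 0]
def e3v : RVec 3 := ![0, 0, 1]
def f1v : RVec 3 := ![0, 1/2, 1/2]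
def f2v : RVec 3 := ![1/3, 1/3, 1/3]

/-- The conditions on the six points `A, A*, B*, C*, C, B` of an elementary path in
`Δ̄⁽³⁾` (here `f₃ = e₃`). -/
def IsElemPath (A As Bs Cs C B : RVec 3) : Prop :=
  A ∈ segment ℝ f2v e3v ∧
  As ∈ segment ℝ f2v f1v ∩ segment ℝ A e2v ∧
  Bs ∈ segment ℝ As f1v ∧
  Cs ∈ DeltaBar3 ∩ segment ℝ Bs e3v ∧
  C ∈ DeltaBar3 ∩ segment ℝ Cs e2v ∧
  B ∈ segment ℝ A e3v ∩ segment ℝ C e1v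

/-- The strictness conditions for an elementary path: `A, B ∈ L`, `A*, B* ∈ L*`,
`C, C* ∈ Δ⁽³⁾`, where `L` and `L*` are the open segments `(f₂, f₃)` and `(f₂, f₁)`. -/
def IsStrictElemPath (A As Bs Cs C B : RVec 3) : Prop :=
  IsElemPath A As Bs Cs C B ∧
  A ∈ openSegment ℝ f2v e3v ∧ B ∈ openSegment ℝ f2v e3v ∧
  As ∈ openSegment ℝ f2v f1v ∧ Bs ∈ openSegment ℝ f2v f1v ∧
  C ∈ DeltaOpen3 ∧ Cs ∈ DeltaOpen3

/-- The elementary path itself: the closed polygonal chain through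
`A, A*, B*, C*, C, B, A`. -/
def pathSet (A As Bs Cs C B : RVec 3) : Set (RVec 3) :=
  segment ℝ A As ∪ segment ℝ As Bs ∪ segment ℝ Bs Cs ∪
    segment ℝ Cs C ∪ segment ℝ C B ∪ segment ℝ B A

/-- The sum of the coordinates of a vector. -/
def total (v : RVec 3) : ℝ := ∑ i, v i

lemma total_eq (v : RVec 3) : total v = v 0 + v 1 + v 2 := by
  simp [total, Fin.sum_univ_three]

lemma total_add (v w : RVec 3) : total (v + w) = total v + total w := by
  simp [total, Finset.sum_add_distrib]

lemma total_smul (c : ℝ) (v : RVec 3) : total (c • v) = c * total v := by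
  simp [total, Finset.mul_sum]

lemma eVec_apply_eq (k i : Fin 3) : eVec 3 k i = if i = k then 1 else 0 := by
  simp [eVec, Fin.ext_iff]

lemma total_eVec (k : Fin 3) : total (eVec 3 k) = 1 := by
  simp [total, eVec_apply_eq]

/-- The change of slope from `e_ℓ` to `e_k` at the point `v` is allowed in a non-degenerate
system. -/
def SlopeChange (v : RVec 3) (ℓ k : Fin 3) : Prop :=
  (StrictMono v ∧ k ≤ ℓ) ∨ (ℓ ≤ k ∧ v ℓ = v k)

lemma SlopeChange.trans {v : RVec 3} {ℓ m k : Fin 3} (h₁ : SlopeChange v ℓ m)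
    (h₂ : SlopeChange v m k) : SlopeChange v ℓ k := by
  rcases h₁ with ⟨s, h⟩ | ⟨h, e⟩ <;> rcases h₂ with ⟨s', h'⟩ | ⟨h', e'⟩
  · exact Or.inl ⟨s, h'.trans h⟩
  · exact Or.inl ⟨s, (s.injective e') ▸ h⟩
  · exact Or.inl ⟨s', (s'.injective e) ▸ h'⟩
  · exact Or.inr ⟨h.trans h', e.trans e'⟩

/-- The successive vertices `p i` of an infinite polygonal chain whose `i`-th edge is parallel to
`e_{k i}`, subject to the conditions making it the trajectory of a non-degenerate system. -/
structure Chain (p : ℕ → RVec 3) (k : ℕ → Fin 3) : Prop where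
  step : ∀ i, ∃ h : ℝ, 0 ≤ h ∧ p (i + 1) = p i + h • eVec 3 (k i)
  pos : ∀ i c, 0 < p i c
  mono : ∀ i, Monotone (p i)
  change : ∀ i, SlopeChange (p (i + 1)) (k i) (k (i + 1))
  start : StrictMono (p 0)
  unbounded : Tendsto (fun i => total (p i)) atTop atTop

/-- The map following the chain `p`, parametrized by the sum of the coordinates. -/
def follow (p : ℕ → RVec 3) (k : ℕ → Fin 3) (t : ℝ) : RVec 3 :=
  p (sInf {j | t < total (p (j + 1))}) +
    (t - total (p (sInf {j | t < total (p (j + 1))}))) •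
      eVec 3 (k (sInf {j | t < total (p (j + 1))}))

namespace Chain

variable {p : ℕ → RVec 3} {k : ℕ → Fin 3}

lemma step_total (H : Chain p k) (i : ℕ) :
    p (i + 1) = p i + (total (p (i + 1)) - total (p i)) • eVec 3 (k i) := by
  obtain ⟨h, -, e⟩ := H.step i
  have : total (p (i + 1)) - total (p i) = h := by
    rw [e, total_add, total_smul, total_eVec]; ring
  rw [this, e]

lemma total_mono (H : Chain p k) : Monotone fun i => total (p i) := by
  refine monotone_nat_of_le_succ fun i => ?_
  obtain ⟨h, h0, e⟩ := H.step i
  rw [e, total_add, total_smul, total_eVec]; linarith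

lemma exists_index (H : Chain p k) {t : ℝ} (ht : total (p 0) ≤ t) :
    ∃ j, total (p j) ≤ t ∧ t < total (p (j + 1)) ∧ sInf {j | t < total (p (j + 1))} = j := by
  have hne : {j | t < total (p (j + 1))}.Nonempty :=
    (((tendsto_add_atTop_iff_nat 1).2 H.unbounded).eventually_gt_atTop t).exists
  refine ⟨_, ?_, Nat.sInf_mem hne, rfl⟩
  rcases hj : sInf {j | t < total (p (j + 1))} with _ | j
  · exact ht
  · have : j ∉ {j | t < total (p (j + 1))} := Nat.notMem_of_lt_sInf (by omega)
    simpa using this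

lemma eq_and_change (H : Chain p k) (i : ℕ) {j : ℕ} (hij : i + 1 ≤ j) :
    total (p (i + 1)) = total (p j) → p j = p (i + 1) ∧ SlopeChange (p j) (k i) (k j) := by
  induction j, hij using Nat.le_induction with
  | base => exact fun _ => ⟨rfl, H.change i⟩
  | succ j hj ih =>
    intro h
    have h1 : total (p (i + 1)) ≤ total (p j) := H.total_mono hj
    have h2 : total (p j) ≤ total (p (j + 1)) := H.total_mono (Nat.le_succ j)
    obtain ⟨e, c⟩ := ih (by linarith)
    have e' : p (j + 1) = p j := by
      rw [H.step_total j, show total (p (j + 1)) - total (p j) = 0 by linarith]; simp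
    exact ⟨e'.trans e, (e' ▸ c).trans (H.change j)⟩

lemma follow_eq (H : Chain p k) {i : ℕ} {t : ℝ} (h1 : total (p i) ≤ t)
    (h2 : t ≤ total (p (i + 1))) :
    follow p k t = p i + (t - total (p i)) • eVec 3 (k i) := by
  obtain ⟨j, hj1, hj2, hj⟩ := H.exists_index ((H.total_mono (Nat.zero_le i)).trans h1)
  rw [follow, hj]
  rcases lt_trichotomy i j with hij | rfl | hij
  · have h3 : total (p (i + 1)) ≤ total (p j) := H.total_mono hij
    have h4 : t = total (p (i + 1)) := by linarith
    have h5 := (H.eq_and_change i hij (by linarith)).1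
    rw [h5, h4, ← H.step_total i]; simp
  · rfl
  · have h3 : total (p (j + 1)) ≤ total (p i) := H.total_mono hij
    linarith

lemma follow_total (H : Chain p k) (i : ℕ) : follow p k (total (p i)) = p i := by
  rw [H.follow_eq le_rfl (H.total_mono (Nat.le_succ i))]; simp

lemma follow_mem (H : Chain p k) {G : Set (RVec 3)} (hG : Convex ℝ G) {i : ℕ} {t : ℝ}
    (h1 : total (p i) ≤ t) (h2 : t < total (p (i + 1))) (m1 : p i ∈ G) (m2 : p (i + 1) ∈ G) :
    follow p k t ∈ G := by
  rw [H.follow_eq h1 h2.le]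
  have hpos : 0 < total (p (i + 1)) - total (p i) := by linarith
  have := hG.add_smul_sub_mem m1 m2 (t := (t - total (p i)) / (total (p (i + 1)) - total (p i)))
    ⟨by apply div_nonneg <;> linarith, by rw [div_le_one hpos]; linarith⟩
  convert this using 2
  nth_rewrite 2 [H.step_total i]
  rw [add_sub_cancel_left, smul_smul, div_mul_cancel₀ _ hpos.ne']

lemma follow_spec (H : Chain p k) {t : ℝ} (ht : total (p 0) ≤ t) :
    (∀ c, 0 < follow p k t c) ∧ Monotone (follow p k t) ∧ ∑ c, follow p k t c = t := by
  obtain ⟨j, h1, h2, -⟩ := H.exists_index ht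
  have hG : Convex ℝ {v : RVec 3 | (∀ c, 0 < v c) ∧ Monotone v} := by
    rintro v ⟨v1, v2⟩ w ⟨w1, w2⟩ x y hx hy hxy
    refine ⟨fun c => ?_, fun c c' h => ?_⟩
    · simp only [Pi.add_apply, Pi.smul_apply, smul_eq_mul]
      rcases hx.eq_or_lt with rfl | hx
      · have : y = 1 := by linarith
        simpa [this] using w1 c
      · have := mul_pos hx (v1 c)
        have := mul_nonneg hy (w1 c).le
        linarith
    · simp only [Pi.add_apply, Pi.smul_apply, smul_eq_mul]
      have := mul_le_mul_of_nonneg_left (v2 h) hx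
      have := mul_le_mul_of_nonneg_left (w2 h) hy
      linarith
  have := H.follow_mem hG h1 h2 ⟨H.pos _, H.mono _⟩ ⟨H.pos _, H.mono _⟩
  refine ⟨this.1, this.2, ?_⟩
  change total _ = _
  rw [H.follow_eq h1 h2.le, total_add, total_smul, total_eVec]; ring

/-- Around a point of its domain other than the origin, `follow p k` has a left and a right slope
and the change of slope is allowed. -/
lemma follow_slopes (H : Chain p k) {t : ℝ} (ht : total (p 0) < t) :
    ∃ ε > (0 : ℝ), ∃ m ℓ : Fin 3,
      (∀ s ∈ Icc (t - ε) t, follow p k s = follow p k t + (s - t) • eVec 3 ℓ) ∧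
      (∀ s ∈ Icc t (t + ε), follow p k s = follow p k t + (s - t) • eVec 3 m) ∧
      total (p 0) ≤ t - ε ∧ SlopeChange (follow p k t) ℓ m := by
  obtain ⟨j, hj1, hj2, -⟩ := H.exists_index ht.le
  have hex : ∃ i, t ≤ total (p (i + 1)) := ⟨j, hj2.le⟩
  classical
  obtain ⟨i, hi, hmin⟩ : ∃ i, t ≤ total (p (i + 1)) ∧ total (p i) < t := by
    refine ⟨Nat.find hex, Nat.find_spec hex, ?_⟩
    rcases h : Nat.find hex with _ | i
    · exact ht
    · simpa using Nat.find_min hex (m := i) (by omega)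
  have hij : i ≤ j := by
    by_contra hlt
    have : total (p (j + 1)) ≤ total (p i) := H.total_mono (by omega)
    linarith
  refine ⟨min (t - total (p i)) (total (p (j + 1)) - t), lt_min (by linarith) (by linarith),
    k j, k i, ?_, ?_, ?_, ?_⟩
  · rintro s ⟨hs1, hs2⟩
    have := min_le_left (t - total (p i)) (total (p (j + 1)) - t)
    rw [H.follow_eq (i := i) (t := s) (by linarith) (by linarith),
      H.follow_eq (i := i) (t := t) (by linarith) (by linarith), add_assoc, ← add_smul]
    congr 2; ring
  · rintro s ⟨hs1, hs2⟩
    have := min_le_right (t - total (p i)) (total (p (j + 1)) - t)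
    rw [H.follow_eq (i := j) (t := s) (by linarith) (by linarith),
      H.follow_eq (i := j) (t := t) (by linarith) (by linarith), add_assoc, ← add_smul]
    congr 2; ring
  · have := min_le_left (t - total (p i)) (total (p (j + 1)) - t)
    have : total (p 0) ≤ total (p i) := H.total_mono (Nat.zero_le i)
    linarith
  · rcases hij.eq_or_lt with rfl | hlt
    · exact Or.inr ⟨le_rfl, rfl⟩
    · have h3 : total (p (i + 1)) ≤ total (p j) := H.total_mono hlt
      have h4 : t = total (p j) := by linarith
      rw [h4, H.follow_total]
      exact (H.eq_and_change i hlt (by linarith)).2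

lemma eVec_slope_unique {m m' : Fin 3} {x ε ε' : ℝ} {s : ℝ → ℝ} {Q : ℝ → RVec 3}
    (hε : 0 < ε) (hε' : 0 < ε') (hs : ∀ δ, 0 < δ → s δ ≠ x)
    (h : ∀ δ, 0 < δ → δ ≤ ε → Q (s δ) = Q x + (s δ - x) • eVec 3 m)
    (h' : ∀ δ, 0 < δ → δ ≤ ε' → Q (s δ) = Q x + (s δ - x) • eVec 3 m') : m = m' := by
  have hpos : 0 < min ε ε' := lt_min hε hε'
  have e := (h _ hpos (min_le_left _ _)).symm.trans (h' _ hpos (min_le_right _ _))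
  have e2 := smul_right_injective (RVec 3) (sub_ne_zero.2 (hs _ hpos)) (add_left_cancel e)
  have e3 := congrFun e2 m
  by_contra hne
  simp [eVec_apply_eq, hne] at e3

lemma isNSystem (H : Chain p k) : IsNSystem 3 (Ici (total (p 0))) (follow p k) := by
  have h0 : 0 < total (p 0) := by
    rw [total_eq]; linarith [H.pos 0 0, H.pos 0 1, H.pos 0 2]
  refine ⟨Ici_subset_Ici.2 h0.le, ordConnected_Ici, by simp, fun t ht => ?_⟩
  obtain ⟨s1, s2, s3⟩ := H.follow_spec ht
  refine ⟨⟨fun c => (s1 c).le, s2, s3⟩, ?_⟩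
  rcases (show total (p 0) ≤ t from ht).eq_or_lt with rfl | hlt
  · obtain ⟨j, hj1, hj2, -⟩ := H.exists_index (le_refl (total (p 0)))
    refine ⟨total (p (j + 1)) - total (p 0), by linarith, k j, k j, ?_, ?_, ?_⟩
    · rintro s ⟨hs, hs1, hs2⟩
      have : s = total (p 0) := le_antisymm hs2 hs
      simp [this]
    · rintro s ⟨hs, hs1, hs2⟩
      rw [H.follow_eq (i := j) (t := s) (by linarith) (by linarith),
        H.follow_eq (i := j) (t := total (p 0)) (by linarith) (by linarith), add_assoc,
        ← add_smul]
      congr 2; ring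
    · intro _ hk; exact absurd hk (lt_irrefl _)
  · obtain ⟨ε, hε, m, ℓ, hl, hr, -, hc⟩ := H.follow_slopes hlt
    refine ⟨ε, hε, m, ℓ, fun s hs => hl s hs.2, fun s hs => hr s hs.2, fun _ hlm i hi1 hi2 => ?_⟩
    rcases hc with ⟨-, h⟩ | ⟨-, h⟩
    · exact absurd hlm h.not_gt
    · exact le_antisymm ((s2 hi2).trans h.ge) (s2 hi1)

lemma isNonDegenerate (H : Chain p k) :
    IsNonDegenerate 3 (Ici (total (p 0))) (follow p k) := by
  have h0 : 0 < total (p 0) := by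
    rw [total_eq]; linarith [H.pos 0 0, H.pos 0 1, H.pos 0 2]
  refine ⟨H.isNSystem, isClosed_Ici, fun x hx => lt_of_lt_of_le h0 hx, ?_⟩
  rintro q ⟨hq, hq'⟩
  refine ⟨(H.follow_spec hq).1, ?_⟩
  rcases hq' with hq' | ⟨hint, ε, hε, m, ℓ, hml, hl, hr⟩
  · rw [frontier_Ici, mem_singleton_iff] at hq'
    rw [hq', H.follow_total]; exact H.start
  · rw [interior_Ici] at hint
    obtain ⟨ε', hε', m', ℓ', hl', hr', hle, hc⟩ := H.follow_slopes hint
    have e1 : m' = m := eVec_slope_unique (s := fun δ => q + δ) (x := q) hε' hε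
      (fun δ hδ => by simp [hδ.ne'])
      (fun δ hδ hδ' => hr' _ ⟨by linarith, by linarith⟩)
      (fun δ hδ hδ' => hr _ ⟨by have := mem_Ici.1 hq; simp; linarith, by linarith, by linarith⟩)
    have e2 : ℓ' = ℓ := eVec_slope_unique (s := fun δ => q - δ) (x := q) hε' (lt_min hε hε')
      (fun δ hδ => by simp [hδ.ne'])
      (fun δ hδ hδ' => hl' _ ⟨by linarith, by linarith⟩)
      (fun δ hδ hδ' => hl _ ⟨by
        have := min_le_right ε ε'; simp; linarith, by
        have := min_le_left ε ε'; linarith, by linarith⟩)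
    subst e1 e2
    rcases hc with ⟨h, -⟩ | ⟨h, -⟩
    · exact h
    · exact absurd hml h.not_gt

end Chain

/-- The central projection of a vector to the plane where the coordinates sum up to `1`. -/
def nrm (v : RVec 3) : RVec 3 := (total v)⁻¹ • v

/-- The set of vectors with positive coordinate sum whose projection belongs to `T`. -/
def coneOver (T : Set (RVec 3)) : Set (RVec 3) := {v | 0 < total v ∧ nrm v ∈ T}

lemma nrm_smul {c : ℝ} (hc : c ≠ 0) (v : RVec 3) : nrm (c • v) = nrm v := by
  rw [nrm, nrm, total_smul, smul_smul, mul_inv, mul_right_comm, inv_mul_cancel₀ hc, one_mul]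

lemma nrm_of_total {v : RVec 3} (hv : total v = 1) : nrm v = v := by
  simp [nrm, hv]

lemma convex_coneOver {T : Set (RVec 3)} (hT : Convex ℝ T) : Convex ℝ (coneOver T) := by
  rintro v ⟨v1, v2⟩ w ⟨w1, w2⟩ x y hx hy hxy
  have htot : total (x • v + y • w) = x * total v + y * total w := by
    rw [total_add, total_smul, total_smul]
  have hpos : 0 < x * total v + y * total w := by
    rcases hx.eq_or_lt with rfl | hx
    · have : y = 1 := by linarith
      simpa [this] using w1
    · have := mul_pos hx v1
      have := mul_nonneg hy w1.le
      linarith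
  refine ⟨htot ▸ hpos, ?_⟩
  have := hT v2 w2 (a := x * total v / (x * total v + y * total w))
    (b := y * total w / (x * total v + y * total w))
    (div_nonneg (mul_nonneg hx v1.le) hpos.le) (div_nonneg (mul_nonneg hy w1.le) hpos.le)
    (by rw [← add_div, div_self hpos.ne'])
  convert this using 1
  rw [nrm, htot, nrm, nrm, smul_smul, smul_smul, smul_add, smul_smul, smul_smul]
  congr 2
  · field_simp
  · field_simp

namespace Chain

variable {p : ℕ → RVec 3} {k : ℕ → Fin 3}

lemma isSelfSimilar (H : Chain p k) {ρ : ℝ} (hρ : 1 < ρ)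
    (h : ∀ i, ∃ j, p j = ρ • p i ∧ p (j + 1) = ρ • p (i + 1) ∧ k j = k i) :
    IsSelfSimilar 3 (Ici (total (p 0))) (follow p k) := by
  refine ⟨not_bddAbove_Ici _, ρ, hρ, fun q hq => ?_⟩
  have h0 : 0 < total (p 0) := by
    rw [total_eq]; linarith [H.pos 0 0, H.pos 0 1, H.pos 0 2]
  have hq' : total (p 0) ≤ q := hq
  obtain ⟨i, h1, h2, -⟩ := H.exists_index hq'
  obtain ⟨j, e1, e2, e3⟩ := h i
  refine ⟨by simp only [mem_Ici]; nlinarith, ?_⟩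
  rw [H.follow_eq h1 h2.le, H.follow_eq (i := j) (t := ρ * q)
    (by rw [e1, total_smul]; gcongr) (by rw [e2, total_smul]; gcongr), e1, e3, total_smul,
    smul_add, smul_smul]
  congr 2; ring

lemma mem_FSet (H : Chain p k) {x : RVec 3} {v : ℕ → RVec 3} (hv : ∀ n, ∃ i, p i = v n)
    (hmono : StrictMono fun n => total (v n)) (hx : Tendsto (fun n => nrm (v n)) atTop (𝓝 x)) :
    x ∈ FSet 3 (Ici (total (p 0))) (follow p k) := by
  choose φ hφ using hv
  have hφm : StrictMono φ := by
    intro a b hab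
    by_contra hle
    have h1 : total (p (φ b)) ≤ total (p (φ a)) := H.total_mono (not_lt.1 hle)
    rw [hφ, hφ] at h1
    exact absurd (hmono hab) h1.not_gt
  refine ⟨fun n => total (v n), fun n => ?_, hmono, ?_, ?_⟩
  · have := H.total_mono (Nat.zero_le (φ n))
    simpa [hφ] using this
  · have := H.unbounded.comp hφm.tendsto_atTop
    simpa [Function.comp_def, hφ] using this
  · convert hx using 2 with n
    change (total (v n))⁻¹ • follow p k (total (v n)) = _
    rw [← hφ n, H.follow_total, nrm]

lemma FSet_subset (H : Chain p k) {K : Set (RVec 3)} (hK : Convex ℝ K) (hc : IsClosed K)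
    (h : ∀ ε > 0, ∀ᶠ i in atTop, p i ∈ coneOver (Metric.thickening ε K)) :
    FSet 3 (Ici (total (p 0))) (follow p k) ⊆ K := by
  rintro x ⟨q, hqI, -, hq, hx⟩
  rw [← hc.closure_eq, Metric.closure_eq_iInter_cthickening]
  refine mem_iInter₂.2 fun ε hε => ?_
  refine Metric.closure_thickening_subset_cthickening ε K ?_
  refine mem_closure_of_tendsto hx ?_
  obtain ⟨j₀, hj₀⟩ := eventually_atTop.1 (h ε hε)
  filter_upwards [hq.eventually_ge_atTop (total (p j₀))] with n hn
  obtain ⟨j, h1, h2, -⟩ := H.exists_index (hqI n)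
  have hj : j₀ ≤ j := by
    by_contra hlt
    have : total (p (j + 1)) ≤ total (p j₀) := H.total_mono (by omega)
    linarith
  have := H.follow_mem (convex_coneOver (hK.thickening ε)) h1 h2 (hj₀ j hj)
    (hj₀ (j + 1) (by omega))
  have h3 := (H.follow_spec (hqI n)).2.2
  have h4 := this.2
  rwa [nrm, total, h3] at h4

lemma isProperSys (H : Chain p k) (h : ∀ M : ℝ, ∃ i, M < p i 0) :
    IsProperSys 3 (Ici (total (p 0))) (follow p k) := by
  refine ⟨H.isNSystem, fun M => ?_⟩
  obtain ⟨i, hi⟩ := h M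
  refine ⟨total (p i), H.total_mono (Nat.zero_le i), fun c => ?_⟩
  rw [H.follow_total]
  exact hi.trans_le (H.mono i (Fin.zero_le c))

end Chain

/-- Subdivision condition: dividing `[x, y]` into `M` equal parts is fine enough with respect to
the outer data `u < x` and `y < z`, and `M` vanishes exactly when `x = y`. -/
structure Mesh (u x y z : ℝ) (M : ℕ) : Prop where
  pos : 0 < M ↔ x < y
  upper : y - x ≤ M * (z - y)
  lower : (y - x) * (y - u) ≤ M * ((z - x) * (x - u))

lemma exists_mesh {u x y z : ℝ} (h1 : u < x) (h2 : x ≤ y) (h3 : y < z) :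
    ∃ M, Mesh u x y z M := by
  rcases h2.eq_or_lt with rfl | h2
  · exact ⟨0, by simp, by simp, by simp⟩
  · obtain ⟨M, hM⟩ := exists_nat_ge ((y - x) / (z - y) + (y - x) * (y - u) / ((z - x) * (x - u)))
    have p1 : 0 < (y - x) / (z - y) := div_pos (by linarith) (by linarith)
    have p4 : 0 < (z - x) * (x - u) := mul_pos (by linarith) (by linarith)
    have p2 : 0 < (y - x) * (y - u) / ((z - x) * (x - u)) :=
      div_pos (mul_pos (by linarith) (by linarith)) p4
    have p3 : (0 : ℝ) < M := by linarith
    refine ⟨M, ⟨fun _ => h2, fun _ => by exact_mod_cast p3⟩, ?_, ?_⟩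
    · rw [← div_le_iff₀ (by linarith)]; linarith
    · rw [← div_le_iff₀ p4]; linarith

lemma Mesh.scale {u x y z : ℝ} {M : ℕ} (h : Mesh u x y z M) {c : ℝ} (hc : 0 < c) :
    Mesh (c * u) (c * x) (c * y) (c * z) M := by
  refine ⟨?_, ?_, ?_⟩
  · rw [mul_lt_mul_iff_right₀ hc]; exact h.pos
  · have := mul_le_mul_of_nonneg_left h.upper hc.le
    linarith
  · have := mul_le_mul_of_nonneg_left h.lower (mul_pos hc hc).le
    linarith

/-- The points dividing `[x, y]` into `M` equal parts, followed by `z`. -/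
def grid (x y z : ℝ) (M i : ℕ) : ℝ := if i ≤ M then x + i * ((y - x) / M) else z

lemma grid_zero (x y z : ℝ) (M : ℕ) : grid x y z M 0 = x := by simp [grid]

lemma grid_succ_last (x y z : ℝ) (M : ℕ) : grid x y z M (M + 1) = z := by simp [grid]

lemma grid_scale (x y z c : ℝ) (M i : ℕ) :
    grid (c * x) (c * y) (c * z) M i = c * grid x y z M i := by
  unfold grid; split_ifs <;> ring

namespace Mesh

variable {u x y z : ℝ} {M i : ℕ}

lemma grid_last (h : Mesh u x y z M) (h2 : x ≤ y) : grid x y z M M = y := by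
  simp only [grid, le_refl, if_true]
  rcases Nat.eq_zero_or_pos M with rfl | hM
  · have : ¬ x < y := fun hlt => absurd (h.pos.2 hlt) (lt_irrefl _)
    simp; linarith
  · have : (M : ℝ) ≠ 0 := by positivity
    field_simp; ring

lemma grid_mem (h2 : x ≤ y) (hi : i ≤ M) : x ≤ grid x y z M i ∧ grid x y z M i ≤ y := by
  simp only [grid, hi, if_true]
  have h3 : (i : ℝ) ≤ M := by exact_mod_cast hi
  have h4 : 0 ≤ (y - x) / M := div_nonneg (by linarith) (by positivity)
  refine ⟨by have := mul_nonneg (Nat.cast_nonneg (α := ℝ) i) h4; linarith, ?_⟩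
  have h5 := mul_le_mul_of_nonneg_right h3 h4
  have h6 : (M : ℝ) * ((y - x) / M) ≤ y - x := by
    rcases Nat.eq_zero_or_pos M with rfl | hM
    · simp; linarith
    · have : (M : ℝ) ≠ 0 := by positivity
      field_simp; rfl
  linarith

lemma grid_succ (hi : i < M) : grid x y z M (i + 1) = grid x y z M i + (y - x) / M := by
  simp only [grid, hi.le, Nat.succ_le_of_lt hi, if_true]; push_cast; ring

lemma grid_lt_succ (h : Mesh u x y z M) (h2 : x ≤ y) (h3 : y < z) (hi : i ≤ M) :
    grid x y z M i < grid x y z M (i + 1) := by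
  rcases hi.eq_or_lt with rfl | hi
  · rw [grid_succ_last, h.grid_last h2]; exact h3
  · rw [grid_succ hi]
    have hM : 0 < M := by omega
    have : 0 < (y - x) / M := div_pos (by linarith [h.pos.1 hM]) (by positivity)
    linarith

lemma diag_mem {S : Set (ℝ × ℝ)} (hS : Convex ℝ S) (h2 : x ≤ y) (m1 : (x, x) ∈ S)
    (m2 : (y, y) ∈ S) {w : ℝ} (hw : x ≤ w ∧ w ≤ y) : (w, w) ∈ S := by
  rcases h2.eq_or_lt with rfl | h2
  · rwa [le_antisymm hw.2 hw.1]
  · have hpos : 0 < y - x := by linarith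
    have := hS.add_smul_sub_mem m1 m2 (t := (w - x) / (y - x))
      ⟨div_nonneg (by linarith) hpos.le, by rw [div_le_one hpos]; linarith⟩
    convert this using 1
    have : w = x + (w - x) / (y - x) * (y - x) := by field_simp; ring
    ext <;> simpa using this

/-- The zigzag along the diagonal stays in the convex hull of four points. -/
lemma zigzag_mem (h : Mesh u x y z M) (h1 : u < x) (h2 : x ≤ y) (h3 : y < z) {S : Set (ℝ × ℝ)}
    (hS : Convex ℝ S) (m0 : (u, x) ∈ S) (m1 : (x, x) ∈ S) (m2 : (y, y) ∈ S) (m3 : (y, z) ∈ S)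
    (hi : i ≤ M) : (grid x y z M i, grid x y z M (i + 1)) ∈ S := by
  rcases hi.eq_or_lt with rfl | hi
  · rwa [grid_succ_last, h.grid_last h2]
  have hM : (0 : ℝ) < M := by exact_mod_cast (show 0 < M by omega)
  obtain ⟨g1, g2⟩ := grid_mem (z := z) h2 hi.le
  have hd := grid_lt_succ h h2 h3 hi.le
  set g := grid x y z M i
  have e : grid x y z M (i + 1) = g + (y - x) / M := grid_succ hi
  rw [e] at hd ⊢
  set δ := (y - x) / M
  have hδ : 0 < δ := by linarith
  have d1 : δ ≤ z - y := by
    rw [div_le_iff₀ hM]; linarith [h.upper]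
  have d2 : δ * (y - u) ≤ (z - x) * (x - u) := by
    have : δ * (y - u) = (y - x) * (y - u) / M := by simp only [δ]; ring
    rw [this, div_le_iff₀ hM]; linarith [h.lower]
  have hyu : 0 < y - u := by linarith
  have hT := hS.add_smul_sub_mem m0 m3 (t := (g - u) / (y - u))
      ⟨div_nonneg (by linarith) hyu.le, by rw [div_le_one hyu]; linarith⟩
  have hQ := diag_mem hS h2 m1 m2 ⟨g1, g2⟩
  have eT : (u, x) + ((g - u) / (y - u)) • ((y, z) - (u, x)) =
      (g, x + (z - x) * (g - u) / (y - u)) := by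
    ext
    · simp; field_simp; ring
    · simp; ring
  rw [eT] at hT
  have key : g + δ ≤ x + (z - x) * (g - u) / (y - u) := by
    rw [← sub_nonneg]
    have : x + (z - x) * (g - u) / (y - u) - (g + δ) =
      ((z - x) * (g - u) - (g + δ - x) * (y - u)) / (y - u) := by field_simp; ring
    rw [this]
    refine div_nonneg ?_ hyu.le
    have hxy : 0 < y - x := by
      have : 0 < M := by exact_mod_cast hM
      linarith [h.pos.1 this]
    have a1 := mul_le_mul_of_nonneg_left d2 (show 0 ≤ y - g by linarith)
    have a2 := mul_le_mul_of_nonneg_left (mul_le_mul_of_nonneg_right d1 hyu.le)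
      (show 0 ≤ g - x by linarith)
    refine nonneg_of_mul_nonneg_right (a := y - x) ?_ hxy
    linarith
  have hpos : 0 < x + (z - x) * (g - u) / (y - u) - g := by linarith
  have := hS.add_smul_sub_mem hQ hT (t := δ / (x + (z - x) * (g - u) / (y - u) - g))
    ⟨div_nonneg hδ.le hpos.le, by rw [div_le_one hpos]; linarith⟩
  convert this using 1
  ext
  · simp
  · simp only [Prod.mk_sub_mk, Prod.smul_mk, Prod.mk_add_mk, smul_eq_mul]
    rw [div_mul_cancel₀ _ hpos.ne']

end Mesh

/-- Four interlacing sequences of positive numbers governing the successive vertices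
`C, B, A, A*, B*, C*` of a chain of elementary cycles, with numbers of subdivisions for the
zigzags from `B` to `A` and from `A*` to `B*`. -/
structure Interlacing (a b d e : ℕ → ℝ) (M N : ℕ → ℕ) : Prop where
  pos : 0 < a 0
  ad : ∀ n, a n < d n
  da : ∀ n, d n ≤ a (n + 1)
  ae : ∀ n, a (n + 1) < e n
  eb : ∀ n, e n ≤ b n
  bd : ∀ n, b n ≤ d (n + 1)
  lim : Tendsto e atTop atTop
  meshM : ∀ n, Mesh (a n) (d n) (a (n + 1)) (e n) (M n)
  meshN : ∀ n, Mesh (a (n + 1)) (e n) (b n) (e (n + 1)) (N n)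

/-- The states of the chain: `lift12 n i` and `swap12 n i` are the two types of vertices in the part
from `C` to `A*` of the `n`-th cycle, `swap23 n i` and `lift23 n i` are those in the part from `A*`
to the next vertex `C`. -/
inductive CycleState where
  | lift12 (n i : ℕ)
  | swap12 (n i : ℕ)
  | swap23 (n i : ℕ)
  | lift23 (n i : ℕ)

namespace CycleState

/-- The cycle to which a state belongs. -/
def cycle : CycleState → ℕ
  | lift12 n _ => n
  | swap12 n _ => n
  | swap23 n _ => n
  | lift23 n _ => n

/-- The state in the next cycle corresponding to a given state. -/
def shift : CycleState → CycleState
  | lift12 n i => lift12 (n + 1) i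
  | swap12 n i => swap12 (n + 1) i
  | swap23 n i => swap23 (n + 1) i
  | lift23 n i => lift23 (n + 1) i

/-- The direction of the edge starting from a state. -/
def dir : CycleState → Fin 3
  | lift12 _ _ => 0
  | swap12 _ _ => 1
  | swap23 _ _ => 2
  | lift23 _ _ => 1

/-- The states which are actually used. -/
def Valid (M N : ℕ → ℕ) : CycleState → Prop
  | lift12 n i => i ≤ M n
  | swap12 n i => i ≤ M n
  | swap23 n i => i ≤ N n
  | lift23 n i => i ≤ N n

/-- The successor of a state. -/
def next (M N : ℕ → ℕ) : CycleState → CycleState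
  | lift12 n i => swap12 n i
  | swap12 n i => if i < M n then lift12 n (i + 1) else swap23 n 0
  | swap23 n i => lift23 n i
  | lift23 n i => if i < N n then swap23 n (i + 1) else lift12 (n + 1) 0

/-- The point of the chain attached to a state. -/
def point (a b d e : ℕ → ℝ) (M N : ℕ → ℕ) : CycleState → RVec 3
  | lift12 n 0 => ![a n, d n, e n]
  | lift12 n (i + 1) => ![grid (d n) (a (n + 1)) (e n) (M n) i,
      grid (d n) (a (n + 1)) (e n) (M n) (i + 1), e n]
  | swap12 n i => ![grid (d n) (a (n + 1)) (e n) (M n) i,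
      grid (d n) (a (n + 1)) (e n) (M n) i, e n]
  | swap23 n i => ![a (n + 1), grid (e n) (b n) (e (n + 1)) (N n) i,
      grid (e n) (b n) (e (n + 1)) (N n) i]
  | lift23 n i => ![a (n + 1), grid (e n) (b n) (e (n + 1)) (N n) i,
      grid (e n) (b n) (e (n + 1)) (N n) (i + 1)]

/-- The sequence of states. -/
def seq (M N : ℕ → ℕ) (i : ℕ) : CycleState := (next M N)^[i] (lift12 0 0)

variable {M N : ℕ → ℕ}

lemma seq_succ (i : ℕ) : seq M N (i + 1) = next M N (seq M N i) :=
  Function.iterate_succ_apply' _ _ _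

lemma valid_next {s : CycleState} (h : s.Valid M N) : (next M N s).Valid M N := by
  rcases s with ⟨n, i⟩ | ⟨n, i⟩ | ⟨n, i⟩ | ⟨n, i⟩ <;> simp only [next]
  · exact h
  · split_ifs with hi
    · exact hi
    · exact Nat.zero_le _
  · exact h
  · split_ifs with hi
    · exact hi
    · exact Nat.zero_le _

lemma valid_seq (i : ℕ) : (seq M N i).Valid M N := by
  induction i with
  | zero => exact Nat.zero_le _
  | succ i ih => rw [seq_succ]; exact valid_next ih

lemma cycle_mono : Monotone fun i => (seq M N i).cycle := by
  refine monotone_nat_of_le_succ fun i => ?_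
  rw [seq_succ]
  rcases seq M N i with ⟨n, i⟩ | ⟨n, i⟩ | ⟨n, i⟩ | ⟨n, i⟩ <;> simp only [next] <;>
    (try split_ifs) <;> simp [cycle]

lemma reach_cycle {n : ℕ} (h : lift12 n 0 ∈ range (seq M N)) :
    (∀ i ≤ M n, lift12 n i ∈ range (seq M N) ∧ swap12 n i ∈ range (seq M N)) ∧
    (∀ i ≤ N n, swap23 n i ∈ range (seq M N) ∧ lift23 n i ∈ range (seq M N)) := by
  have hstep : ∀ s, s ∈ range (seq M N) → next M N s ∈ range (seq M N) := by
    rintro _ ⟨i, rfl⟩; exact ⟨i + 1, seq_succ i⟩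
  have h1 : ∀ i ≤ M n, lift12 n i ∈ range (seq M N) ∧ swap12 n i ∈ range (seq M N) := by
    intro i
    induction i with
    | zero => exact fun _ => ⟨h, hstep _ h⟩
    | succ i ih =>
      intro hi
      have h2 := hstep _ (ih (by omega)).2
      rw [next, if_pos (by omega)] at h2
      exact ⟨h2, hstep _ h2⟩
  refine ⟨h1, fun i => ?_⟩
  induction i with
  | zero =>
    intro _
    have h2 := hstep _ (h1 (M n) le_rfl).2
    rw [next, if_neg (lt_irrefl _)] at h2
    exact ⟨h2, hstep _ h2⟩
  | succ i ih =>
    intro hi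
    have h2 := hstep _ (ih (by omega)).2
    rw [next, if_pos (by omega)] at h2
    exact ⟨h2, hstep _ h2⟩

lemma reach_start (n : ℕ) : lift12 n 0 ∈ range (seq M N) := by
  induction n with
  | zero => exact ⟨0, rfl⟩
  | succ n ih =>
    obtain ⟨i, hi⟩ := ((reach_cycle ih).2 (N n) le_rfl).2
    exact ⟨i + 1, by rw [seq_succ, hi, next, if_neg (lt_irrefl _)]⟩

lemma reach_of_valid {s : CycleState} (h : s.Valid M N) : s ∈ range (seq M N) := by
  rcases s with ⟨n, i⟩ | ⟨n, i⟩ | ⟨n, i⟩ | ⟨n, i⟩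
  · exact ((reach_cycle (reach_start n)).1 i h).1
  · exact ((reach_cycle (reach_start n)).1 i h).2
  · exact ((reach_cycle (reach_start n)).2 i h).1
  · exact ((reach_cycle (reach_start n)).2 i h).2

end CycleState

lemma vec3_eq_add {x y z x' y' z' h : ℝ} {k : Fin 3} (hx : x' = x + if 0 = k then h else 0)
    (hy : y' = y + if 1 = k then h else 0) (hz : z' = z + if 2 = k then h else 0) :
    ![x', y', z'] = ![x, y, z] + h • eVec 3 k := by
  ext c; fin_cases c <;> simp [hx, hy, hz, eVec_apply_eq]

lemma monotone_vec3 {x y z : ℝ} (h1 : x ≤ y) (h2 : y ≤ z) : Monotone (![x, y, z] : RVec 3) := by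
  intro i j hij
  fin_cases i <;> fin_cases j <;> simp at hij ⊢ <;> linarith

lemma strictMono_vec3 {x y z : ℝ} (h1 : x < y) (h2 : y < z) :
    StrictMono (![x, y, z] : RVec 3) := by
  intro i j hij
  fin_cases i <;> fin_cases j <;> simp at hij ⊢ <;> linarith

namespace Interlacing

open CycleState

variable {a b d e : ℕ → ℝ} {M N : ℕ → ℕ}

lemma a_pos (H : Interlacing a b d e M N) (n : ℕ) : 0 < a n := by
  induction n with
  | zero => exact H.pos
  | succ n ih => linarith [H.ad n, H.da n]

lemma b_lt (H : Interlacing a b d e M N) (n : ℕ) : b n < e (n + 1) := by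
  linarith [H.bd n, H.da (n + 1), H.ae (n + 1)]

lemma step_point (H : Interlacing a b d e M N) {s : CycleState} (hs : s.Valid M N) :
    ∃ h : ℝ, 0 ≤ h ∧
      point a b d e M N (next M N s) = point a b d e M N s + h • eVec 3 s.dir := by
  rcases s with ⟨n, _ | i⟩ | ⟨n, i⟩ | ⟨n, i⟩ | ⟨n, i⟩ <;> simp only [next]
  · refine ⟨d n - a n, by linarith [H.ad n], vec3_eq_add ?_ ?_ ?_⟩ <;>
      simp [grid_zero, dir]
  · have := (H.meshM n).grid_lt_succ (H.da n) (H.ae n) (Nat.le_of_succ_le hs)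
    refine ⟨_, sub_nonneg.2 this.le, vec3_eq_add ?_ ?_ ?_⟩ <;> simp [dir]
  · have := (H.meshM n).grid_lt_succ (H.da n) (H.ae n) hs
    refine ⟨_, sub_nonneg.2 this.le, ?_⟩
    split_ifs with hi
    · refine vec3_eq_add ?_ ?_ ?_ <;> simp [dir]
    · obtain rfl : i = M n := le_antisymm hs (not_lt.1 hi)
      refine vec3_eq_add ?_ ?_ ?_ <;>
        simp [dir, grid_zero, (H.meshM n).grid_last (H.da n), grid_succ_last]
  · have := (H.meshN n).grid_lt_succ (H.eb n) (H.b_lt n) hs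
    refine ⟨_, sub_nonneg.2 this.le, vec3_eq_add ?_ ?_ ?_⟩ <;> simp [dir]
  · split_ifs with hi
    · have := (H.meshN n).grid_lt_succ (H.eb n) (H.b_lt n) hs
      refine ⟨_, sub_nonneg.2 this.le, vec3_eq_add ?_ ?_ ?_⟩ <;> simp [dir]
    · obtain rfl : i = N n := le_antisymm hs (not_lt.1 hi)
      refine ⟨d (n + 1) - b n, sub_nonneg.2 (H.bd n), vec3_eq_add ?_ ?_ ?_⟩ <;>
        simp [dir, (H.meshN n).grid_last (H.eb n), grid_succ_last]

lemma point_mono (H : Interlacing a b d e M N) {s : CycleState} (hs : s.Valid M N) :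
    (∀ c, 0 < point a b d e M N s c) ∧ Monotone (point a b d e M N s) := by
  have key : ∀ v : RVec 3, 0 < v 0 → Monotone v → (∀ c, 0 < v c) ∧ Monotone v :=
    fun v h1 h2 => ⟨fun c => h1.trans_le (h2 (Fin.zero_le c)), h2⟩
  have ha := H.a_pos
  have had := H.ad
  rcases s with ⟨n, _ | i⟩ | ⟨n, i⟩ | ⟨n, i⟩ | ⟨n, i⟩
  · exact key _ (ha n) (monotone_vec3 (had n).le (by linarith [H.da n, H.ae n]))
  · have h1 := (H.meshM n).grid_lt_succ (H.da n) (H.ae n) (Nat.le_of_succ_le hs)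
    have h2 := Mesh.grid_mem (z := e n) (H.da n) (Nat.le_of_succ_le hs)
    have h3 := Mesh.grid_mem (z := e n) (H.da n) hs
    exact key _ (show 0 < grid _ _ _ _ _ by linarith [ha n, had n])
      (monotone_vec3 h1.le (by linarith [H.ae n]))
  · have h2 := Mesh.grid_mem (z := e n) (H.da n) hs
    exact key _ (show 0 < grid _ _ _ _ _ by linarith [ha n, had n])
      (monotone_vec3 le_rfl (by linarith [H.ae n]))
  · have h2 := Mesh.grid_mem (z := e (n + 1)) (H.eb n) hs
    exact key _ (ha (n + 1)) (monotone_vec3 (by linarith [H.ae n]) le_rfl)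
  · have h1 := (H.meshN n).grid_lt_succ (H.eb n) (H.b_lt n) hs
    have h2 := Mesh.grid_mem (z := e (n + 1)) (H.eb n) hs
    exact key _ (ha (n + 1)) (monotone_vec3 (by linarith [H.ae n]) h1.le)

lemma strictMono_start (H : Interlacing a b d e M N) (n : ℕ) :
    StrictMono (point a b d e M N (lift12 n 0)) :=
  strictMono_vec3 (H.ad n) (by linarith [H.da n, H.ae n])

lemma slopeChange_point (H : Interlacing a b d e M N) {s : CycleState} (hs : s.Valid M N) :
    SlopeChange (point a b d e M N (next M N s)) s.dir (next M N s).dir := by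
  rcases s with ⟨n, i⟩ | ⟨n, i⟩ | ⟨n, i⟩ | ⟨n, i⟩ <;> simp only [next]
  · exact Or.inr ⟨by simp [dir], rfl⟩
  · split_ifs with hi
    · have h1 := (H.meshM n).grid_lt_succ (H.da n) (H.ae n) hs
      have h2 := Mesh.grid_mem (z := e n) (H.da n) (Nat.succ_le_of_lt hi)
      exact Or.inl ⟨strictMono_vec3 h1 (by linarith [H.ae n]), by simp [dir]⟩
    · exact Or.inr ⟨by simp [dir], rfl⟩
  · have h1 := (H.meshN n).grid_lt_succ (H.eb n) (H.b_lt n) hs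
    have h2 := Mesh.grid_mem (z := e (n + 1)) (H.eb n) hs
    exact Or.inl ⟨strictMono_vec3 (by linarith [H.ae n]) h1, by simp [dir]⟩
  · split_ifs with hi
    · exact Or.inr ⟨by simp [dir], rfl⟩
    · exact Or.inl ⟨H.strictMono_start (n + 1), by simp [dir]⟩

lemma strictMono_a (H : Interlacing a b d e M N) : StrictMono a :=
  strictMono_nat_of_lt_succ fun n => (H.ad n).trans_le (H.da n)

lemma strictMono_d (H : Interlacing a b d e M N) : StrictMono d :=
  strictMono_nat_of_lt_succ fun n => by linarith [H.da n, H.ae n, H.eb n, H.bd n]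

lemma strictMono_e (H : Interlacing a b d e M N) : StrictMono e :=
  strictMono_nat_of_lt_succ fun n => (H.eb n).trans_lt (H.b_lt n)

lemma strictMono_b (H : Interlacing a b d e M N) : StrictMono b :=
  strictMono_nat_of_lt_succ fun n => (H.b_lt n).trans_le (H.eb (n + 1))

lemma chain (H : Interlacing a b d e M N) :
    Chain (fun i => point a b d e M N (seq M N i)) (fun i => (seq M N i).dir) := by
  have hstep : ∀ i, ∃ h : ℝ, 0 ≤ h ∧ point a b d e M N (seq M N (i + 1)) =
      point a b d e M N (seq M N i) + h • eVec 3 (seq M N i).dir := fun i => by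
    rw [seq_succ]; exact H.step_point (valid_seq i)
  refine ⟨hstep, fun i => (H.point_mono (valid_seq i)).1,
    fun i => (H.point_mono (valid_seq i)).2, fun i => ?_, H.strictMono_start 0, ?_⟩
  · simp only [seq_succ]; exact H.slopeChange_point (valid_seq i)
  · refine tendsto_atTop_atTop_of_monotone (monotone_nat_of_le_succ fun i => ?_) fun x => ?_
    · obtain ⟨h, h0, eq⟩ := hstep i
      rw [eq, total_add, total_smul, total_eVec]; linarith
    · obtain ⟨n, hn⟩ := (H.lim.eventually_ge_atTop x).exists
      obtain ⟨i, hi⟩ := reach_start (M := M) (N := N) n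
      refine ⟨i, ?_⟩
      rw [hi, total_eq]
      have := H.a_pos n
      have := H.ad n
      simp [point]; linarith

lemma unbounded_first (H : Interlacing a b d e M N) (x : ℝ) :
    ∃ i, x < point a b d e M N (seq M N i) 0 := by
  obtain ⟨n, hn⟩ := (H.lim.eventually_gt_atTop x).exists
  obtain ⟨i, hi⟩ := reach_start (M := M) (N := N) (n + 2)
  refine ⟨i, ?_⟩
  rw [hi]
  simp only [point, Matrix.cons_val_zero]
  linarith [H.eb n, H.bd n, H.da (n + 1)]

lemma convex_slice {G : Set (RVec 3)} (hG : Convex ℝ G) (z : ℝ) :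
    Convex ℝ {w : ℝ × ℝ | ![w.1, w.2, z] ∈ G} := by
  intro v hv w hw x y hx hy hxy
  have := hG hv hw hx hy hxy
  simp only [mem_ofPred_eq]
  convert this using 1
  ext c; fin_cases c <;> simp
  rw [← add_mul, hxy, one_mul]

lemma convex_slice' {G : Set (RVec 3)} (hG : Convex ℝ G) (z : ℝ) :
    Convex ℝ {w : ℝ × ℝ | ![z, w.1, w.2] ∈ G} := by
  intro v hv w hw x y hx hy hxy
  have := hG hv hw hx hy hxy
  simp only [mem_ofPred_eq]
  convert this using 1
  ext c; fin_cases c <;> simp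
  rw [← add_mul, hxy, one_mul]

lemma point_mem (H : Interlacing a b d e M N) {G : Set (RVec 3)} (hG : Convex ℝ G)
    {s : CycleState} (hs : s.Valid M N)
    (m1 : ![a s.cycle, d s.cycle, e s.cycle] ∈ G) (m2 : ![d s.cycle, d s.cycle, e s.cycle] ∈ G)
    (m3 : ![a (s.cycle + 1), a (s.cycle + 1), e s.cycle] ∈ G)
    (m4 : ![a (s.cycle + 1), e s.cycle, e s.cycle] ∈ G)
    (m5 : ![a (s.cycle + 1), b s.cycle, b s.cycle] ∈ G)
    (m6 : ![a (s.cycle + 1), b s.cycle, e (s.cycle + 1)] ∈ G) :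
    point a b d e M N s ∈ G := by
  rcases s with ⟨n, _ | i⟩ | ⟨n, i⟩ | ⟨n, i⟩ | ⟨n, i⟩ <;> simp only [cycle] at m1 m2 m3 m4 m5 m6
  · exact m1
  · exact (H.meshM n).zigzag_mem (H.ad n) (H.da n) (H.ae n) (convex_slice hG (e n)) m1 m2 m3 m4
      (Nat.le_of_succ_le hs)
  · exact Mesh.diag_mem (convex_slice hG (e n)) (H.da n) m2 m3 (Mesh.grid_mem (H.da n) hs)
  · exact Mesh.diag_mem (convex_slice' hG (a (n + 1))) (H.eb n) m4 m5 (Mesh.grid_mem (H.eb n) hs)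
  · exact (H.meshN n).zigzag_mem (H.ae n) (H.eb n) (H.b_lt n) (convex_slice' hG (a (n + 1)))
      m3 m4 m5 m6 hs

/-- The first vertex of the chain attached to interlacing sequences gives the left end of the
domain of the associated system. -/
def domain (a d e : ℕ → ℝ) : Set ℝ := Ici (total ![a 0, d 0, e 0])

/-- The system attached to interlacing sequences. -/
def system (a b d e : ℕ → ℝ) (M N : ℕ → ℕ) : ℝ → RVec 3 :=
  follow (fun i => point a b d e M N (seq M N i)) (fun i => (seq M N i).dir)

lemma isProperSys (H : Interlacing a b d e M N) :
    IsProperSys 3 (domain a d e) (system a b d e M N) :=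
  H.chain.isProperSys H.unbounded_first

lemma isNonDegenerate (H : Interlacing a b d e M N) :
    IsNonDegenerate 3 (domain a d e) (system a b d e M N) :=
  H.chain.isNonDegenerate

lemma mem_FSet (H : Interlacing a b d e M N) {A As Bs Cs C B : RVec 3}
    (hC : Tendsto (fun n => nrm ![a n, d n, e n]) atTop (𝓝 C))
    (hB : Tendsto (fun n => nrm ![d n, d n, e n]) atTop (𝓝 B))
    (hA : Tendsto (fun n => nrm ![a (n + 1), a (n + 1), e n]) atTop (𝓝 A))
    (hAs : Tendsto (fun n => nrm ![a (n + 1), e n, e n]) atTop (𝓝 As))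
    (hBs : Tendsto (fun n => nrm ![a (n + 1), b n, b n]) atTop (𝓝 Bs))
    (hCs : Tendsto (fun n => nrm ![a (n + 1), b n, e (n + 1)]) atTop (𝓝 Cs)) :
    ({A, As, Bs, Cs, C, B} : Set (RVec 3)) ⊆ FSet 3 (domain a d e) (system a b d e M N) := by
  have key : ∀ (v : ℕ → RVec 3) (x : RVec 3) (s : ℕ → CycleState),
      (∀ n, (s n).Valid M N ∧ point a b d e M N (s n) = v n) →
      StrictMono (fun n => total (v n)) → Tendsto (fun n => nrm (v n)) atTop (𝓝 x) →
      x ∈ FSet 3 (domain a d e) (system a b d e M N) := fun v x s hs hm hx =>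
    H.chain.mem_FSet (v := v) (fun n => by
      obtain ⟨i, hi⟩ := reach_of_valid (hs n).1
      exact ⟨i, by simp only [hi, (hs n).2]⟩) hm hx
  have ha := H.strictMono_a
  have hb := H.strictMono_b
  have hd := H.strictMono_d
  have he := H.strictMono_e
  rintro x (rfl | rfl | rfl | rfl | rfl | rfl)
  · refine key _ _ (fun n => swap12 n (M n)) (fun n => ⟨le_rfl, ?_⟩) (fun i j hij => ?_) hA
    · simp [point, (H.meshM n).grid_last (H.da n)]
    · have := ha (Nat.succ_lt_succ hij); have := he hij
      simp [total_eq] at *; linarith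
  · refine key _ _ (fun n => swap23 n 0) (fun n => ⟨Nat.zero_le _, ?_⟩) (fun i j hij => ?_) hAs
    · simp [point, grid_zero]
    · have := ha (Nat.succ_lt_succ hij); have := he hij
      simp [total_eq] at *; linarith
  · refine key _ _ (fun n => swap23 n (N n)) (fun n => ⟨le_rfl, ?_⟩) (fun i j hij => ?_) hBs
    · simp [point, (H.meshN n).grid_last (H.eb n)]
    · have := ha (Nat.succ_lt_succ hij); have := hb hij
      simp [total_eq] at *; linarith
  · refine key _ _ (fun n => lift23 n (N n)) (fun n => ⟨le_rfl, ?_⟩) (fun i j hij => ?_) hCs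
    · simp [point, (H.meshN n).grid_last (H.eb n), grid_succ_last]
    · have := ha (Nat.succ_lt_succ hij); have := hb hij; have := he (Nat.succ_lt_succ hij)
      simp [total_eq] at *; linarith
  · refine key _ _ (fun n => lift12 n 0) (fun n => ⟨Nat.zero_le _, ?_⟩) (fun i j hij => ?_) hC
    · simp [point]
    · have := ha hij; have := hd hij; have := he hij
      simp [total_eq] at *; linarith
  · refine key _ _ (fun n => swap12 n 0) (fun n => ⟨Nat.zero_le _, ?_⟩) (fun i j hij => ?_) hB
    · simp [point, grid_zero]
    · have := hd hij; have := he hij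
      simp [total_eq] at *; linarith

lemma FSet_subset (H : Interlacing a b d e M N) {A As Bs Cs C B : RVec 3}
    (hC : Tendsto (fun n => nrm ![a n, d n, e n]) atTop (𝓝 C))
    (hB : Tendsto (fun n => nrm ![d n, d n, e n]) atTop (𝓝 B))
    (hA : Tendsto (fun n => nrm ![a (n + 1), a (n + 1), e n]) atTop (𝓝 A))
    (hAs : Tendsto (fun n => nrm ![a (n + 1), e n, e n]) atTop (𝓝 As))
    (hBs : Tendsto (fun n => nrm ![a (n + 1), b n, b n]) atTop (𝓝 Bs))
    (hCs : Tendsto (fun n => nrm ![a (n + 1), b n, e (n + 1)]) atTop (𝓝 Cs)) :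
    FSet 3 (domain a d e) (system a b d e M N) ⊆
      convexHull ℝ ({A, As, Bs, Cs, C, B} : Set (RVec 3)) := by
  set V : Set (RVec 3) := {A, As, Bs, Cs, C, B} with hV
  have hVfin : V.Finite := toFinite _
  refine H.chain.FSet_subset (convex_convexHull ℝ V) (hVfin.isClosed_convexHull ℝ) fun ε hε => ?_
  have hmem : ∀ {v : ℕ → RVec 3} {x : RVec 3}, x ∈ V → (∀ n, 0 < total (v n)) →
      Tendsto (fun n => nrm (v n)) atTop (𝓝 x) →
      ∀ᶠ n in atTop, v n ∈ coneOver (Metric.thickening ε (convexHull ℝ V)) := by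
    intro v x hx hpos hv
    filter_upwards [hv.eventually (Metric.isOpen_thickening.mem_nhds
      (Metric.self_subset_thickening hε _ (subset_convexHull ℝ V hx)))] with n hn
    exact ⟨hpos n, hn⟩
  have pa := H.a_pos
  have pd : ∀ n, 0 < d n := fun n => (pa n).trans (H.ad n)
  have pe : ∀ n, 0 < e n := fun n => (pa (n + 1)).trans (H.ae n)
  have pb : ∀ n, 0 < b n := fun n => (pe n).trans_le (H.eb n)
  have hpos : ∀ {x y z : ℝ}, 0 < x → 0 < y → 0 < z → 0 < total ![x, y, z] := by
    intro x y z hx hy hz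
    simp [total_eq]; linarith
  have hev := (hmem (by simp [hV]) (fun n => hpos (pa n) (pd n) (pe n)) hC).and <|
    (hmem (by simp [hV]) (fun n => hpos (pd n) (pd n) (pe n)) hB).and <|
    (hmem (by simp [hV]) (fun n => hpos (pa (n + 1)) (pa (n + 1)) (pe n)) hA).and <|
    (hmem (by simp [hV]) (fun n => hpos (pa (n + 1)) (pe n) (pe n)) hAs).and <|
    (hmem (by simp [hV]) (fun n => hpos (pa (n + 1)) (pb n) (pb n)) hBs).and <|
    (hmem (by simp [hV]) (fun n => hpos (pa (n + 1)) (pb n) (pe (n + 1))) hCs)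
  obtain ⟨n₀, hn₀⟩ := eventually_atTop.1 hev
  obtain ⟨i₀, hi₀⟩ := reach_start (M := M) (N := N) n₀
  filter_upwards [eventually_ge_atTop i₀] with i hi
  have hcyc : n₀ ≤ (seq M N i).cycle := by
    have := cycle_mono (M := M) (N := N) hi
    simpa [hi₀, cycle] using this
  obtain ⟨m1, m2, m3, m4, m5, m6⟩ := hn₀ _ hcyc
  exact H.point_mem (convex_coneOver ((convex_convexHull ℝ V).thickening ε)) (valid_seq i)
    m1 m2 m3 m4 m5 m6

lemma isSelfSimilar (H : Interlacing a b d e M N) {ρ : ℝ} (hρ : 1 < ρ)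
    (ha : ∀ n, a (n + 1) = ρ * a n) (hb : ∀ n, b (n + 1) = ρ * b n)
    (hd : ∀ n, d (n + 1) = ρ * d n) (he : ∀ n, e (n + 1) = ρ * e n)
    (hM : ∀ n, M (n + 1) = M n) (hN : ∀ n, N (n + 1) = N n) :
    IsSelfSimilar 3 (domain a d e) (system a b d e M N) := by
  have hpt : ∀ s : CycleState, point a b d e M N s.shift = ρ • point a b d e M N s := by
    rintro (⟨n, _ | i⟩ | ⟨n, i⟩ | ⟨n, i⟩ | ⟨n, i⟩) <;>
      (ext c; fin_cases c) <;> simp [shift, point, ha, hb, hd, he, hM, hN, grid_scale]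
  have hvalid : ∀ s : CycleState, s.Valid M N → s.shift.Valid M N := by
    rintro (⟨n, i⟩ | ⟨n, i⟩ | ⟨n, i⟩ | ⟨n, i⟩) <;> simp [shift, Valid, hM, hN]
  have hnext : ∀ s : CycleState, next M N s.shift = (next M N s).shift := by
    rintro (⟨n, i⟩ | ⟨n, i⟩ | ⟨n, i⟩ | ⟨n, i⟩) <;> simp only [shift, next, hM, hN] <;>
      split_ifs <;> rfl
  have hdir : ∀ s : CycleState, s.shift.dir = s.dir := by
    rintro (⟨n, i⟩ | ⟨n, i⟩ | ⟨n, i⟩ | ⟨n, i⟩) <;> rfl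
  refine H.chain.isSelfSimilar hρ fun i => ?_
  obtain ⟨j, hj⟩ := reach_of_valid (hvalid _ (valid_seq (M := M) (N := N) i))
  refine ⟨j, ?_, ?_, ?_⟩
  · simp only [hj, hpt]
  · simp only [seq_succ, hj, hnext, hpt]
  · simp only [hj, hdir]

end Interlacing

lemma convexHull_pathSet (A As Bs Cs C B : RVec 3) :
    convexHull ℝ (pathSet A As Bs Cs C B) = convexHull ℝ {A, As, Bs, Cs, C, B} := by
  set V : Set (RVec 3) := {A, As, Bs, Cs, C, B} with hV
  have hc := convex_convexHull ℝ V
  have hm : ∀ x ∈ V, x ∈ convexHull ℝ V := fun x hx => subset_convexHull ℝ V hx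
  apply Subset.antisymm
  · refine convexHull_min ?_ hc
    have hs : ∀ x ∈ V, ∀ y ∈ V, segment ℝ x y ⊆ convexHull ℝ V :=
      fun x hx y hy => hc.segment_subset (hm x hx) (hm y hy)
    refine union_subset (union_subset (union_subset (union_subset (union_subset ?_ ?_) ?_) ?_)
      ?_) ?_ <;> apply hs <;> simp [hV]
  · refine convexHull_mono ?_
    rintro x (rfl | rfl | rfl | rfl | rfl | rfl) <;>
      simp [pathSet, left_mem_segment, right_mem_segment]

lemma eq_nrm_of_smul {v : RVec 3} {x y c : ℝ} (hv : total v = 1) (hc : c ≠ 0)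
    (h0 : v 0 = c * x) (h1 : v 1 = c * y) (h2 : v 2 = c) : v = nrm ![x, y, 1] := by
  have : v = c • ![x, y, 1] := by
    ext i; fin_cases i <;> simp [h0, h1, h2]
  rw [← nrm_smul hc, ← this, nrm_of_total hv]

/-- The vertices of an elementary path are determined by four parameters. -/
lemma IsElemPath.exists_params {A As Bs Cs C B : RVec 3} (h : IsElemPath A As Bs Cs C B) :
    ∃ α σ τ κ : ℝ, 0 ≤ τ ∧ τ ≤ κ ∧ κ ≤ α ∧ α ≤ 1 ∧ 0 ≤ σ ∧ σ ≤ 1 ∧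
      A = nrm ![α, α, 1] ∧ As = nrm ![α, 1, 1] ∧ Bs = nrm ![α * σ, 1, 1] ∧
      Cs = nrm ![α * σ * τ, τ, 1] ∧ C = nrm ![α * σ * τ, κ, 1] ∧ B = nrm ![κ, κ, 1] ∧
      (IsStrictElemPath A As Bs Cs C B → 0 < τ ∧ α < 1 ∧ 0 < σ) := by
  obtain ⟨⟨x₁, y₁, hx₁, hy₁, hxy₁, eA⟩, ⟨⟨x₂, y₂, hx₂, hy₂, hxy₂, eAs⟩,
    ⟨x₃, y₃, hx₃, hy₃, hxy₃, eAs'⟩⟩, ⟨x₄, y₄, hx₄, hy₄, hxy₄, eBs⟩,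
    ⟨⟨c0, c1, c2, c3⟩, ⟨x₅, y₅, hx₅, hy₅, hxy₅, eCs⟩⟩,
    ⟨⟨d0, d1, d2, d3⟩, ⟨x₆, y₆, hx₆, hy₆, hxy₆, eC⟩⟩,
    ⟨⟨x₇, y₇, hx₇, hy₇, hxy₇, eB⟩, ⟨x₈, y₈, hx₈, hy₈, hxy₈, eB'⟩⟩⟩ := h
  have hA := fun i => congrFun eA i
  have hAs := fun i => congrFun eAs i
  have hAs' := fun i => congrFun eAs' i
  have hBs := fun i => congrFun eBs i
  have hCs := fun i => congrFun eCs i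
  have hC := fun i => congrFun eC i
  have hB := fun i => congrFun eB i
  have hB' := fun i => congrFun eB' i
  simp only [Fin.forall_fin_succ, Pi.add_apply, Pi.smul_apply, smul_eq_mul,
    f1v, f2v, e1v, e2v, e3v] at hA hAs hAs' hBs hCs hC hB hB'
  simp at hA hAs hAs' hBs hCs hC hB hB'
  obtain ⟨A0, A1, A2⟩ := hA
  obtain ⟨As0, As1, As2⟩ := hAs
  obtain ⟨As0', As1', As2'⟩ := hAs'
  obtain ⟨Bs0, Bs1, Bs2⟩ := hBs
  obtain ⟨Cs0, Cs1, Cs2⟩ := hCs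
  obtain ⟨C0, C1, C2⟩ := hC
  obtain ⟨B0, B1, B2⟩ := hB
  obtain ⟨B0', B1', B2'⟩ := hB'
  have pA : 0 < A 2 := by linarith
  have pAs : 0 < As 2 := by linarith
  have pBs : 0 < Bs 2 := by
    rcases hx₄.eq_or_lt with rfl | hx₄
    · linarith
    · have := mul_pos hx₄ pAs
      linarith
  have pCs : 0 < Cs 2 := by linarith
  have pC : 0 < C 2 := by linarith
  have px₆ : 0 < x₆ := by
    by_contra hn
    have : x₆ = 0 := by linarith
    rw [this] at C2; linarith
  have tBs : Bs 0 + Bs 1 + Bs 2 = 1 := by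
    rw [← Bs0, ← Bs1, ← Bs2, ← As0, ← As1, ← As2]
    linear_combination hxy₄ + x₄ * hxy₂
  have tB : B 0 + B 1 + B 2 = 1 := by
    rw [← B0, ← B1, ← B2, ← A0, ← A1, ← A2]
    linear_combination hxy₇ + x₇ * hxy₁
  have pB : 0 < B 2 := by
    rcases hx₇.eq_or_lt with rfl | hx₇
    · linarith
    · have := mul_pos hx₇ pA
      linarith
  obtain ⟨α, hα⟩ : ∃ α, A 0 = A 2 * α := ⟨A 0 / A 2, by field_simp⟩
  have α0 : 0 ≤ α := nonneg_of_mul_nonneg_right (a := A 2) (by linarith) pA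
  have α1 : α ≤ 1 := le_of_mul_le_mul_left (a := A 2) (by linarith) pA
  have hAs : As 0 = As 2 * α := by rw [← As0', ← As2', hα]; ring
  obtain ⟨σ, hσ, σ0, σ1⟩ : ∃ σ, Bs 0 = Bs 2 * (α * σ) ∧ 0 ≤ σ ∧ σ ≤ 1 := by
    rcases α0.eq_or_lt with rfl | hpos
    · exact ⟨1, by rw [← Bs0, hAs]; ring, zero_le_one, le_rfl⟩
    · have hp : 0 < Bs 2 * α := mul_pos pBs hpos
      refine ⟨Bs 0 / (Bs 2 * α), by field_simp, div_nonneg ?_ hp.le, ?_⟩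
      · rw [← Bs0, ← As0]; positivity
      · rw [div_le_one hp, ← Bs0, ← Bs2, hAs]
        have := mul_nonneg hy₄ hpos.le
        linarith
  have hBs12 : Bs 1 = Bs 2 := by rw [← Bs1, ← Bs2, ← As1, ← As2]
  obtain ⟨τ, hτ⟩ : ∃ τ, Cs 1 = Cs 2 * τ := ⟨Cs 1 / Cs 2, by field_simp⟩
  have τ0 : 0 ≤ τ := nonneg_of_mul_nonneg_right (a := Cs 2) (by linarith) pCs
  have hCs0 : Cs 0 = Cs 2 * (α * σ * τ) := by
    rw [show Cs 2 * (α * σ * τ) = Cs 2 * τ * (α * σ) by ring, ← hτ, ← Cs0, ← Cs1, hσ, hBs12]; ring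
  obtain ⟨κ, hκ⟩ : ∃ κ, C 1 = C 2 * κ := ⟨C 1 / C 2, by field_simp⟩
  have hτκ : τ ≤ κ := by
    refine le_of_mul_le_mul_left (a := C 2) ?_ pC
    rw [← hκ, ← C1, hτ, ← C2]; linarith
  have hB1 : B 1 = B 2 * κ := by rw [← B1', hκ, ← B2']; ring
  have hB01 : B 0 = B 1 := by rw [← B0, ← B1, ← A0, ← A1]
  have hκα : κ ≤ α := by
    refine le_of_mul_le_mul_left (a := B 2) ?_ pB
    rw [← hB1, ← hB01, ← B0, hα, ← B2]
    have := mul_nonneg hy₇ α0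
    linarith
  refine ⟨α, σ, τ, κ, τ0, hτκ, hκα, α1, σ0, σ1,
    eq_nrm_of_smul (by rw [total_eq]; linarith) pA.ne' hα (by linarith) rfl,
    eq_nrm_of_smul (by rw [total_eq]; linarith) pAs.ne' hAs (by linarith) rfl,
    eq_nrm_of_smul (by rw [total_eq]; exact tBs) pBs.ne' hσ (by linarith) rfl,
    eq_nrm_of_smul (by rw [total_eq]; exact c3) pCs.ne' hCs0 hτ rfl,
    eq_nrm_of_smul (by rw [total_eq]; exact d3) pC.ne' ?_ hκ rfl,
    eq_nrm_of_smul (by rw [total_eq]; exact tB) pB.ne' (by linarith) hB1 rfl, ?_⟩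
  · rw [← C0, hCs0, ← C2]; ring
  · rintro ⟨-, ⟨u, v, hu, hv, huv, eA'⟩, -, -, ⟨u', v', hu', hv', huv', eBs'⟩, -, ⟨q0, q1, q2, q3⟩⟩
    have eA0 := congrFun eA' 0
    have eA2 := congrFun eA' 2
    have eBs0 := congrFun eBs' 0
    simp [f1v, f2v, e3v] at eA0 eA2 eBs0
    refine ⟨?_, ?_, ?_⟩
    · exact pos_of_mul_pos_right (b := τ) (a := Cs 2) (by linarith) pCs.le
    · refine lt_of_mul_lt_mul_left (a := A 2) ?_ pA.le
      linarith
    · refine σ0.lt_of_ne ?_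
      rintro rfl
      have : Bs 0 = 0 := by rw [hσ]; ring
      linarith

/-- The sequence with first term `1` whose consecutive quotients are `1 / (σ n * τ (n + 1))`. -/
def heights (σ τ : ℕ → ℝ) : ℕ → ℝ
  | 0 => 1
  | n + 1 => heights σ τ n / (σ n * τ (n + 1))

/-- The smallest coordinates of the vertices `C` of the cycles with given parameters. -/
def lows (α σ τ : ℕ → ℝ) : ℕ → ℝ
  | 0 => α 0 * σ 0 * τ 0
  | n + 1 => α n * heights σ τ n

lemma tendsto_nrm {x y u v w : ℕ → ℝ} {X Y : ℝ} (hX : 0 ≤ X) (hY : 0 ≤ Y)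
    (hx : Tendsto x atTop (𝓝 X)) (hy : Tendsto y atTop (𝓝 Y))
    (h : ∀ n, w n ≠ 0 ∧ u n = w n * x n ∧ v n = w n * y n) :
    Tendsto (fun n => nrm ![u n, v n, w n]) atTop (𝓝 (nrm ![X, Y, 1])) := by
  have he : ∀ n, nrm ![u n, v n, w n] = nrm ![x n, y n, 1] := fun n => by
    obtain ⟨h0, h1, h2⟩ := h n
    rw [← nrm_smul h0 ![x n, y n, 1]]
    congr 1
    ext i; fin_cases i <;> simp [h1, h2]
  simp only [he]
  have hvec : Tendsto (fun n => (![x n, y n, 1] : RVec 3)) atTop (𝓝 ![X, Y, 1]) := by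
    rw [tendsto_pi_nhds]
    intro i; fin_cases i
    · simpa using hx
    · simpa using hy
    · simp
  have htot : Tendsto (fun n => total ![x n, y n, 1]) atTop (𝓝 (total ![X, Y, 1])) := by
    simp only [total_eq]
    simpa using (hx.add hy).add_const 1
  exact (htot.inv₀ (by simp [total_eq]; positivity)).smul hvec

/-- The constraints on the parameters of a strict elementary path. -/
structure StrictParams (α σ τ κ : ℝ) : Prop where
  τ_pos : 0 < τ
  τκ : τ ≤ κ
  κα : κ ≤ α
  α_lt : α < 1
  σ_pos : 0 < σ
  σ_le : σ ≤ 1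

lemma heights_pos {α σ τ κ : ℕ → ℝ} (hp : ∀ n, StrictParams (α n) (σ n) (τ n) (κ n)) (n : ℕ) :
    0 < heights σ τ n := by
  induction n with
  | zero => exact zero_lt_one
  | succ n ih => exact div_pos ih (mul_pos (hp n).σ_pos (hp (n + 1)).τ_pos)

lemma heights_div {α σ τ κ : ℕ → ℝ} (hp : ∀ n, StrictParams (α n) (σ n) (τ n) (κ n)) (n : ℕ) :
    heights σ τ n / σ n = heights σ τ (n + 1) * τ (n + 1) := by
  have := (hp n).σ_pos.ne'
  have := (hp (n + 1)).τ_pos.ne'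
  rw [heights]; field_simp

lemma exists_interlacing {α σ τ κ : ℕ → ℝ}
    (hp : ∀ n, StrictParams (α n) (σ n) (τ n) (κ n))
    (hlim : Tendsto (heights σ τ) atTop atTop) :
    ∃ M N, Interlacing (lows α σ τ) (fun n => heights σ τ n / σ n)
      (fun n => heights σ τ n * κ n) (heights σ τ) M N ∧
      ∀ ρ : ℝ, 0 < ρ → (∀ n, lows α σ τ (n + 1) = ρ * lows α σ τ n) →
        (∀ n, heights σ τ (n + 1) = ρ * heights σ τ n) → (∀ n, σ (n + 1) = σ n) →
        (∀ n, κ (n + 1) = κ n) →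
        ∃ M N, Interlacing (lows α σ τ) (fun n => heights σ τ n / σ n)
          (fun n => heights σ τ n * κ n) (heights σ τ) (fun _ => M) (fun _ => N) := by
  have he := heights_pos hp
  have pα : ∀ n, 0 < α n := fun n => (hp n).τ_pos.trans_le ((hp n).τκ.trans (hp n).κα)
  have ae : ∀ n, lows α σ τ (n + 1) < heights σ τ n := fun n => by
    simpa [lows] using mul_lt_mul_of_pos_right (hp n).α_lt (he n)
  have eb : ∀ n, heights σ τ n ≤ heights σ τ n / σ n := fun n => by
    rw [le_div_iff₀ (hp n).σ_pos]
    simpa using mul_le_mul_of_nonneg_left (hp n).σ_le (he n).le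
  have bd : ∀ n, heights σ τ n / σ n ≤ heights σ τ (n + 1) * κ (n + 1) := fun n => by
    rw [heights_div hp]
    exact mul_le_mul_of_nonneg_left (hp (n + 1)).τκ (he (n + 1)).le
  have da : ∀ n, heights σ τ n * κ n ≤ lows α σ τ (n + 1) := fun n => by
    rw [lows, mul_comm (α n)]
    exact mul_le_mul_of_nonneg_left (hp n).κα (he n).le
  have ad : ∀ n, lows α σ τ n < heights σ τ n * κ n := fun n => by
    rcases n with _ | n
    · simp only [lows, heights, one_mul]
      have h1 : α 0 * σ 0 < 1 :=
        (mul_le_of_le_one_right (pα 0).le (hp 0).σ_le).trans_lt (hp 0).α_lt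
      have h2 := mul_lt_mul_of_pos_right h1 (hp 0).τ_pos
      linarith [(hp 0).τκ]
    · linarith [ae n, eb n, bd n]
  have b_lt : ∀ n, heights σ τ n / σ n < heights σ τ (n + 1) := fun n => by
    linarith [bd n, da (n + 1), ae (n + 1)]
  have pos : 0 < lows α σ τ 0 := mul_pos (mul_pos (pα 0) (hp 0).σ_pos) (hp 0).τ_pos
  have hM := fun n => exists_mesh (ad n) (da n) (ae n)
  have hN := fun n => exists_mesh (ae n) (eb n) (b_lt n)
  choose M hM using hM
  choose N hN using hN
  refine ⟨M, N, ⟨pos, ad, da, ae, eb, bd, hlim, hM, hN⟩, fun ρ hρ hl hh hσ hκ => ?_⟩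
  have hM' : ∀ n, Mesh (lows α σ τ n) (heights σ τ n * κ n) (lows α σ τ (n + 1))
      (heights σ τ n) (M 0) := fun n => by
    induction n with
    | zero => exact hM 0
    | succ n ih =>
      have := ih.scale hρ
      rwa [← mul_assoc, ← hl, ← hl, ← hh, ← hκ] at this
  have hN' : ∀ n, Mesh (lows α σ τ (n + 1)) (heights σ τ n) (heights σ τ n / σ n)
      (heights σ τ (n + 1)) (N 0) := fun n => by
    induction n with
    | zero => exact hN 0
    | succ n ih =>
      have := ih.scale hρ
      rwa [← mul_div_assoc, ← hl, ← hh, ← hh, ← hσ] at this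
  exact ⟨M 0, N 0, pos, ad, da, ae, eb, bd, hlim, hM', hN'⟩

lemma FSet_bounds {α σ τ κ : ℕ → ℝ} {α' σ' τ' κ' : ℝ}
    (hp : ∀ n, StrictParams (α n) (σ n) (τ n) (κ n))
    (hα : Tendsto α atTop (𝓝 α')) (hσ : Tendsto σ atTop (𝓝 σ'))
    (hτ : Tendsto τ atTop (𝓝 τ')) (hκ : Tendsto κ atTop (𝓝 κ')) {M N : ℕ → ℕ}
    (H : Interlacing (lows α σ τ) (fun n => heights σ τ n / σ n)
      (fun n => heights σ τ n * κ n) (heights σ τ) M N) {V : Set (RVec 3)}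
    (hV : V = {nrm ![α', α', 1], nrm ![α', 1, 1], nrm ![α' * σ', 1, 1],
      nrm ![α' * σ' * τ', τ', 1], nrm ![α' * σ' * τ', κ', 1], nrm ![κ', κ', 1]}) :
    ∃ (I : Set ℝ) (P : ℝ → RVec 3), I = Interlacing.domain (lows α σ τ)
      (fun n => heights σ τ n * κ n) (heights σ τ) ∧
      P = Interlacing.system (lows α σ τ) (fun n => heights σ τ n / σ n)
        (fun n => heights σ τ n * κ n) (heights σ τ) M N ∧
      V ⊆ FSet 3 I P ∧ FSet 3 I P ⊆ convexHull ℝ V := by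
  have he := fun n => (heights_pos hp n).ne'
  have pτ := fun n => (hp n).τ_pos.le
  have pκ := fun n => (pτ n).trans (hp n).τκ
  have pα := fun n => (pκ n).trans (hp n).κα
  have pα' : 0 ≤ α' := ge_of_tendsto' hα pα
  have pσ' : 0 ≤ σ' := ge_of_tendsto' hσ fun n => (hp n).σ_pos.le
  have pτ' : 0 ≤ τ' := ge_of_tendsto' hτ pτ
  have pκ' : 0 ≤ κ' := ge_of_tendsto' hκ pκ
  have hτ1 := (tendsto_add_atTop_iff_nat 1).2 hτ
  have hκ1 := (tendsto_add_atTop_iff_nat 1).2 hκ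
  have low_eq : ∀ n, lows α σ τ (n + 1) =
      heights σ τ (n + 1) * (α n * σ n * τ (n + 1)) := fun n => by
    rw [lows, show heights σ τ (n + 1) * (α n * σ n * τ (n + 1)) =
      heights σ τ (n + 1) * τ (n + 1) * (α n * σ n) by ring, ← heights_div hp]
    have := (hp n).σ_pos.ne'
    field_simp
  have hb : ∀ n, heights σ τ n / σ n ≠ 0 := fun n => div_ne_zero (he n) (hp n).σ_pos.ne'
  have low_eq' : ∀ n, lows α σ τ (n + 1) = heights σ τ n / σ n * (α n * σ n) := fun n => by
    have := (hp n).σ_pos.ne'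
    rw [lows]; field_simp
  have tC : Tendsto (fun n => nrm ![lows α σ τ n, heights σ τ n * κ n, heights σ τ n]) atTop
      (𝓝 (nrm ![α' * σ' * τ', κ', 1])) := by
    rw [← tendsto_add_atTop_iff_nat 1]
    exact tendsto_nrm (by positivity) pκ' ((hα.mul hσ).mul hτ1) hκ1
      fun n => ⟨he _, low_eq n, rfl⟩
  have tB : Tendsto (fun n => nrm ![heights σ τ n * κ n, heights σ τ n * κ n, heights σ τ n]) atTop
      (𝓝 (nrm ![κ', κ', 1])) :=
    tendsto_nrm pκ' pκ' hκ hκ fun n => ⟨he _, rfl, rfl⟩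
  have tA : Tendsto (fun n => nrm ![lows α σ τ (n + 1), lows α σ τ (n + 1), heights σ τ n]) atTop
      (𝓝 (nrm ![α', α', 1])) :=
    tendsto_nrm pα' pα' hα hα fun n => ⟨he _, mul_comm _ _, mul_comm _ _⟩
  have tAs : Tendsto (fun n => nrm ![lows α σ τ (n + 1), heights σ τ n, heights σ τ n]) atTop
      (𝓝 (nrm ![α', 1, 1])) :=
    tendsto_nrm pα' zero_le_one hα tendsto_const_nhds
      fun n => ⟨he _, mul_comm _ _, (mul_one _).symm⟩
  have tBs : Tendsto (fun n => nrm ![lows α σ τ (n + 1), heights σ τ n / σ n,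
      heights σ τ n / σ n]) atTop (𝓝 (nrm ![α' * σ', 1, 1])) :=
    tendsto_nrm (by positivity) zero_le_one (hα.mul hσ) tendsto_const_nhds
      fun n => ⟨hb n, low_eq' n, (mul_one _).symm⟩
  have tCs : Tendsto (fun n => nrm ![lows α σ τ (n + 1), heights σ τ n / σ n,
      heights σ τ (n + 1)]) atTop (𝓝 (nrm ![α' * σ' * τ', τ', 1])) :=
    tendsto_nrm (by positivity) pτ' ((hα.mul hσ).mul hτ1) hτ1
      fun n => ⟨he _, low_eq n, heights_div hp n⟩
  subst hV
  exact ⟨_, _, rfl, rfl, H.mem_FSet tC tB tA tAs tBs tCs, H.FSet_subset tC tB tA tAs tBs tCs⟩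

/-- Every admissible choice of parameters is the limit of strict ones, for which the heights of the
cycles tend to infinity. -/
lemma exists_strictParams_tendsto {α' σ' τ' κ' : ℝ} (h1 : 0 ≤ τ') (h2 : τ' ≤ κ') (h3 : κ' ≤ α')
    (h4 : α' ≤ 1) (h5 : 0 ≤ σ') (h6 : σ' ≤ 1) :
    ∃ α σ τ κ : ℕ → ℝ, (∀ n, StrictParams (α n) (σ n) (τ n) (κ n)) ∧
      Tendsto α atTop (𝓝 α') ∧ Tendsto σ atTop (𝓝 σ') ∧ Tendsto τ atTop (𝓝 τ') ∧
      Tendsto κ atTop (𝓝 κ') ∧ Tendsto (heights σ τ) atTop atTop := by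
  set ε : ℕ → ℝ := fun n => 1 / ((n : ℝ) + 3) with hε
  have hlim : Tendsto ε atTop (𝓝 0) :=
    (tendsto_atTop_add_const_right _ 3 tendsto_natCast_atTop_atTop).const_div_atTop 1
  have pε : ∀ n, 0 < ε n := fun n => by simp only [hε]; positivity
  have ε_le : ∀ n, ε n ≤ 1 / 3 := fun n => by
    simp only [hε]
    apply one_div_le_one_div_of_le <;> norm_num
  have htend : ∀ x : ℝ, Tendsto (fun n => (1 - 2 * ε n) * x + ε n) atTop (𝓝 x) := fun x => by
    simpa using (((hlim.const_mul 2).const_sub 1).mul_const x).add hlim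
  have hm : ∀ n {x y : ℝ}, x ≤ y → (1 - 2 * ε n) * x + ε n ≤ (1 - 2 * ε n) * y + ε n :=
    fun n x y hxy => by
      have := mul_le_mul_of_nonneg_left hxy (show 0 ≤ 1 - 2 * ε n by linarith [ε_le n])
      linarith
  have hlow : ∀ n {x : ℝ}, 0 ≤ x → 0 < (1 - 2 * ε n) * x + ε n := fun n x hx => by
    have := hm n hx
    linarith [pε n]
  have hup : ∀ n {x : ℝ}, x ≤ 1 → (1 - 2 * ε n) * x + ε n ≤ 1 - ε n := fun n x hx => by
    have := hm n hx
    linarith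
  have hp : ∀ n, StrictParams ((1 - 2 * ε n) * α' + ε n) ((1 - 2 * ε n) * σ' + ε n)
      ((1 - 2 * ε n) * τ' + ε n) ((1 - 2 * ε n) * κ' + ε n) := fun n =>
    ⟨hlow n h1, hm n h2, hm n h3, by linarith [hup n h4, pε n], hlow n h5,
      by linarith [hup n h6, pε n]⟩
  refine ⟨_, _, _, _, hp, htend _, htend _, htend _, htend _, ?_⟩
  have hgrow : ∀ n : ℕ, ((n : ℝ) + 3) / 3 ≤ heights (fun n => (1 - 2 * ε n) * σ' + ε n)
      (fun n => (1 - 2 * ε n) * τ' + ε n) n := fun n => by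
    induction n with
    | zero => simp [heights]
    | succ n ih =>
      rw [heights]
      set t := (1 - 2 * ε (n + 1)) * τ' + ε (n + 1)
      set s := (1 - 2 * ε n) * σ' + ε n
      have hs : 0 < s := (hp n).σ_pos
      have ht : 0 < t := (hp (n + 1)).τ_pos
      have hst : s * t ≤ 1 - ε (n + 1) :=
        (mul_le_of_le_one_left ht.le (hp n).σ_le).trans
          (hup (n + 1) ((h2.trans h3).trans h4))
      have hε' : ((n + 1 : ℕ) + 3 : ℝ) / 3 * (1 - ε (n + 1)) = ((n : ℝ) + 3) / 3 := by
        simp only [hε]; push_cast; field_simp; ring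
      rw [le_div_iff₀ (mul_pos hs ht)]
      refine le_trans ?_ ih
      rw [← hε']
      exact mul_le_mul_of_nonneg_left hst (by positivity)
  refine tendsto_atTop_mono hgrow (Tendsto.atTop_div_const (by norm_num) ?_)
  exact tendsto_atTop_add_const_right _ 3 tendsto_natCast_atTop_atTop

lemma heights_const (σ τ : ℝ) (n : ℕ) :
    heights (fun _ => σ) (fun _ => τ) n = (1 / (σ * τ)) ^ n := by
  induction n with
  | zero => simp [heights]
  | succ n ih => rw [heights, ih, pow_succ]; ring

/-- **Lemma (realizing an elementary path).** Let `E` be an elementary path with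
vertex set `V = {A, A*, B*, C*, C, B}` and convex hull `K`.  Then there is a proper
`3`-system `P` with `V ⊆ F(P) ⊆ K`, hence `K(P) = K`; if `E` is strict, `P` can
moreover be chosen self-similar and non-degenerate. -/
theorem realize_elemPath (A As Bs Cs C B : RVec 3)
    (h : IsElemPath A As Bs Cs C B) :
    (∃ (I : Set ℝ) (P : ℝ → RVec 3), IsProperSys 3 I P ∧
      ({A, As, Bs, Cs, C, B} : Set (RVec 3)) ⊆ FSet 3 I P ∧
      FSet 3 I P ⊆ convexHull ℝ (pathSet A As Bs Cs C B) ∧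
      convexHull ℝ (FSet 3 I P) = convexHull ℝ (pathSet A As Bs Cs C B)) ∧
    (IsStrictElemPath A As Bs Cs C B →
      ∃ (I : Set ℝ) (P : ℝ → RVec 3), IsProperSys 3 I P ∧
        IsSelfSimilar 3 I P ∧ IsNonDegenerate 3 I P ∧
        ({A, As, Bs, Cs, C, B} : Set (RVec 3)) ⊆ FSet 3 I P ∧
        FSet 3 I P ⊆ convexHull ℝ (pathSet A As Bs Cs C B) ∧
        convexHull ℝ (FSet 3 I P) = convexHull ℝ (pathSet A As Bs Cs C B)) := by
  obtain ⟨α, σ, τ, κ, h1, h2, h3, h4, h5, h6, eA, eAs, eBs, eCs, eC, eB, hs⟩ := h.exists_params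
  have hV : ({A, As, Bs, Cs, C, B} : Set (RVec 3)) = {nrm ![α, α, 1], nrm ![α, 1, 1],
      nrm ![α * σ, 1, 1], nrm ![α * σ * τ, τ, 1], nrm ![α * σ * τ, κ, 1], nrm ![κ, κ, 1]} := by
    rw [eA, eAs, eBs, eCs, eC, eB]
  rw [convexHull_pathSet]
  have hull : ∀ {F : Set (RVec 3)}, ({A, As, Bs, Cs, C, B} : Set (RVec 3)) ⊆ F →
      F ⊆ convexHull ℝ {A, As, Bs, Cs, C, B} →
      convexHull ℝ F = convexHull ℝ {A, As, Bs, Cs, C, B} := fun hF hF' =>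
    Subset.antisymm (convexHull_min hF' (convex_convexHull ℝ _)) (convexHull_mono hF)
  constructor
  · obtain ⟨α', σ', τ', κ', hp, tα, tσ, tτ, tκ, hlim⟩ :=
      exists_strictParams_tendsto h1 h2 h3 h4 h5 h6
    obtain ⟨M, N, H, -⟩ := exists_interlacing hp hlim
    obtain ⟨I, P, rfl, rfl, hF, hF'⟩ := FSet_bounds hp tα tσ tτ tκ H hV
    exact ⟨_, _, H.isProperSys, hF, hF', hull hF hF'⟩
  · intro hstrict
    obtain ⟨q1, q2, q3⟩ := hs hstrict
    have hp : ∀ _ : ℕ, StrictParams α σ τ κ := fun _ => ⟨q1, h2, h3, q2, q3, h6⟩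
    have hστ : σ * τ < 1 :=
      (mul_le_of_le_one_left h1 h6).trans_lt ((h2.trans h3).trans_lt q2)
    have hρ : 1 < 1 / (σ * τ) := by
      rw [lt_div_iff₀ (mul_pos q3 q1)]; linarith
    have hh : ∀ n, heights (fun _ => σ) (fun _ => τ) (n + 1) =
        1 / (σ * τ) * heights (fun _ => σ) (fun _ => τ) n := fun n => by
      rw [heights_const, heights_const, pow_succ]; ring
    have hl : ∀ n, lows (fun _ => α) (fun _ => σ) (fun _ => τ) (n + 1) =
        1 / (σ * τ) * lows (fun _ => α) (fun _ => σ) (fun _ => τ) n := fun n => by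
      rcases n with _ | n
      · simp only [lows, heights]; field_simp
      · rw [lows, hh, lows]; ring
    have hlim : Tendsto (heights (fun _ => σ) (fun _ => τ)) atTop atTop := by
      simpa only [← heights_const] using tendsto_pow_atTop_atTop_of_one_lt hρ
    obtain ⟨-, -, -, hself⟩ := exists_interlacing hp hlim
    obtain ⟨M, N, H⟩ := hself _ (by positivity) hl hh (fun _ => rfl) (fun _ => rfl)
    obtain ⟨I, P, rfl, rfl, hF, hF'⟩ := FSet_bounds hp tendsto_const_nhds tendsto_const_nhds
      tendsto_const_nhds tendsto_const_nhds H hV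
    refine ⟨_, _, H.isProperSys, H.isSelfSimilar hρ hl (fun n => ?_) (fun n => ?_) hh
      (fun _ => rfl) (fun _ => rfl), H.isNonDegenerate, hF, hF', hull hF hF'⟩
    · rw [hh, mul_div_assoc]
    · rw [hh, mul_assoc]
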